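/- arXiv:1905.05978 — 4 statements merged into one kernel-verified Lean document; each statement's English description precedes it below -/
import Mathlib

section
/- There is an absolute constant c > 0 such that for all sufficiently large N the following holds. Let 1 ≤ k ≤ (log N)/2, let f be a gentle mapping, let (Y_i)_{i≥1} be i.i.d. uniform random vectors in Σ_N, write Y := (Y_1,…,Y_k), and for A ⊂ Σ_N set q(A) := μ(A ∩ ⋂_{i=1}^k H(f_i(Y)) = ∅) and N* := ⌊N/(log N)^{1/2}⌋. If q(A) ≥ (log N)^{-1/3}, then μ(A ∩ ⋂_{i=1}^{kN*} H(Y_i) = ∅) ≥ 1 − exp(−c q(A) N*). -/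
open scoped Classical

noncomputable section


/-- A point of the discrete cube `Σ_N = {-1,1}^N`, encoded by booleans
(`true ↦ +1`, `false ↦ -1`). -/
abbrev Cube (N : ℕ) := Fin N → Bool

/-- The `±1` value encoded by a boolean. -/
def pmVal (b : Bool) : ℝ := if b then 1 else -1

/-- The inner product `x · y = ∑ i x^i y^i` on `Σ_N`. -/
def cubeDot {N : ℕ} (x y : Cube N) : ℝ := ∑ i, pmVal (x i) * pmVal (y i)

/-- The half cube `H(x) := {y ∈ Σ_N : x · y ≥ κ √N}`. -/
def halfCube {N : ℕ} (κ : ℝ) (x : Cube N) : Set (Cube N) :=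
  {y | cubeDot x y ≥ κ * Real.sqrt N}

/-- The sign-switching action of `g ∈ Σ_N` on `x ∈ Σ_N`: `(g∘x)^i = g^i x^i`.
In the boolean encoding the product of signs `g^i x^i` is `+1` iff `g^i = x^i`. -/
def signSwitch {N : ℕ} (g : Cube N) (x : Cube N) : Cube N := fun i => g i == x i

/-- A mapping `f = (f_1, …, f_{k+1}) : Σ_N^{k+1} → Σ_N^{k+1}` is gentle (with
constant `C₂`) if it commutes with every sign switch `g ∈ Σ_N` (acting
componentwise) and moves each coordinate vector by Hamming distance at most
`2^{k+1} C₂ (N log N)^{1/2}`. -/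
def Gentle {N k : ℕ} (C₂ : ℝ)
    (f : (Fin (k + 1) → Cube N) → (Fin (k + 1) → Cube N)) : Prop :=
  (∀ g : Cube N, ∀ Y : Fin (k + 1) → Cube N,
      f (fun i => signSwitch g (Y i)) = fun i => signSwitch g (f Y i)) ∧
    ∀ Y : Fin (k + 1) → Cube N, ∀ i : Fin (k + 1),
      (hammingDist (Y i) (f Y i) : ℝ) ≤
        2 ^ (k + 1) * C₂ * Real.sqrt (N * Real.log N)

/-- The probability of an event `E` under the uniform distribution on a finite
type (modelling i.i.d. uniform random vectors). -/
def unifP {α : Type*} [Fintype α] (E : Set α) : ℝ :=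
  (E.ncard : ℝ) / (Fintype.card α)

/-- `N* := ⌊N / (log N)^{1/2}⌋`. -/
def Nstar (N : ℕ) : ℕ := ⌊(N : ℝ) / Real.sqrt (Real.log N)⌋₊

lemma unifP_eq_sum {α : Type*} [Fintype α] (E : Set α) :
    unifP E = (∑ z, if z ∈ E then (1 : ℝ) else 0) / Fintype.card α := by
  unfold unifP
  congr 1
  rw [Finset.sum_boole, Set.ncard_eq_toFinset_card']
  congr 2
  ext z
  simp

lemma unifP_nonneg {α : Type*} [Fintype α] (E : Set α) : 0 ≤ unifP E := by
  unfold unifP; positivity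

lemma unifP_mono {α : Type*} [Fintype α] {E F : Set α} (h : E ⊆ F) : unifP E ≤ unifP F := by
  unfold unifP
  gcongr
  exact Set.toFinite F

lemma unifP_union_le {α : Type*} [Fintype α] (E F : Set α) :
    unifP (E ∪ F) ≤ unifP E + unifP F := by
  unfold unifP
  rw [← add_div]
  gcongr
  exact_mod_cast Set.ncard_union_le E F

lemma unifP_exists_le {α ι : Type*} [Fintype α] [Fintype ι] (E : ι → Set α) (p : ℝ)
    (h : ∀ i, unifP (E i) ≤ p) : unifP {z | ∃ i, z ∈ E i} ≤ Fintype.card ι * p := by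
  have h1 : unifP {z | ∃ i, z ∈ E i} ≤ ∑ i, unifP (E i) := by
    simp only [unifP_eq_sum]
    rw [← Finset.sum_div, Finset.sum_comm]
    gcongr with z
    by_cases hz : ∃ i, z ∈ E i
    · rw [if_pos (by exact hz)]
      obtain ⟨i, hi⟩ := hz
      have := Finset.single_le_sum (f := fun i => if z ∈ E i then (1 : ℝ) else 0)
        (fun i _ => by positivity) (Finset.mem_univ i)
      simpa [hi] using this
    · rw [if_neg (by exact hz)]
      exact Finset.sum_nonneg (fun i _ => by positivity)
  refine h1.trans ((Finset.sum_le_sum fun i _ => h i).trans ?_)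
  simp

lemma unifP_compl {α : Type*} [Fintype α] [Nonempty α] (E : Set α) :
    unifP E = 1 - unifP Eᶜ := by
  have hc : (Fintype.card α : ℝ) ≠ 0 := by positivity
  unfold unifP
  rw [eq_sub_iff_add_eq, ← add_div, div_eq_one_iff_eq hc]
  have := Set.ncard_add_ncard_compl E
  rw [Nat.card_eq_fintype_card] at this
  exact_mod_cast this

lemma unifP_equiv {α β : Type*} [Fintype α] [Fintype β] (e : α ≃ β) (E : Set β) :
    unifP {z | e z ∈ E} = unifP E := by
  rw [unifP_eq_sum, unifP_eq_sum, Fintype.card_congr e]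
  congr 1
  exact Fintype.sum_equiv e _ _ (fun z => by simp)

lemma unifP_markov {α : Type*} [Fintype α] (h : α → ℝ) (hh : ∀ z, 0 ≤ h z) (c M : ℝ)
    (hc : 0 < c) (hM : ∑ z, h z ≤ Fintype.card α * M) (hM0 : 0 ≤ M) :
    unifP {z | c ≤ h z} ≤ M / c := by
  rw [unifP_eq_sum]
  apply div_le_of_le_mul₀ (by positivity) (by positivity)
  have : ∑ z, (if z ∈ {z | c ≤ h z} then (1 : ℝ) else 0) ≤ ∑ z, h z / c := by
    gcongr with z
    split_ifs with hz
    · rw [le_div_iff₀ hc, one_mul]; exact hz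
    · have := hh z; positivity
  refine this.trans ?_
  rw [← Finset.sum_div, div_mul_eq_mul_div, mul_comm M]
  gcongr

/-- averaging over a family of bijections -/
lemma unifP_average {α γ : Type*} [Fintype α] [Fintype γ] [Nonempty γ] (e : γ → α ≃ α)
    (E : Set α) (p : ℝ) (hp : 0 ≤ p) (h : ∀ z, unifP {g | e g z ∈ E} ≤ p) : unifP E ≤ p := by
  have hg : (0 : ℝ) < Fintype.card γ := by positivity
  rw [unifP_eq_sum]
  apply div_le_of_le_mul₀ (by positivity) hp
  have h1 : ∀ g, ∑ z, (if z ∈ E then (1 : ℝ) else 0) = ∑ z, if e g z ∈ E then (1 : ℝ) else 0 :=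
    fun g => ((e g).sum_comp (fun z => if z ∈ E then (1 : ℝ) else 0)).symm
  have h2 : (Fintype.card γ : ℝ) * ∑ z, (if z ∈ E then (1 : ℝ) else 0)
      = ∑ z, ∑ g, if e g z ∈ E then (1 : ℝ) else 0 := by
    rw [Finset.sum_comm, ← Finset.sum_congr rfl (fun g _ => h1 g)]
    simp
  have h3 : ∀ z, (∑ g, if e g z ∈ E then (1 : ℝ) else 0) ≤ Fintype.card γ * p := by
    intro z
    have := h z
    rw [unifP_eq_sum, div_le_iff₀ hg] at this
    rw [mul_comm]
    simpa using this
  have h4 := Finset.sum_le_sum (fun z (_ : z ∈ (Finset.univ : Finset α)) => h3 z)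
  rw [← h2] at h4
  simp only [Finset.sum_const, Finset.card_univ, nsmul_eq_mul] at h4
  have : (Fintype.card γ : ℝ) * ∑ z, (if z ∈ E then (1 : ℝ) else 0) ≤ 
    Fintype.card γ * (p * Fintype.card α) := by linarith
  exact le_of_mul_le_mul_left this hg

lemma mgf_bound {β : Type*} [Fintype β] [Nonempty β] (n : ℕ) (S : Set β) (a : ℝ) :
    ∑ Z : Fin n → β, Real.exp (a * ∑ j, if Z j ∈ S then (1 : ℝ) else 0)
      ≤ Fintype.card (Fin n → β) * Real.exp (n * (unifP S * (Real.exp a - 1))) := by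
  have hc : (0 : ℝ) < Fintype.card β := by positivity
  have h1 : ∀ Z : Fin n → β, Real.exp (a * ∑ j, if Z j ∈ S then (1 : ℝ) else 0)
      = ∏ j, Real.exp (a * if Z j ∈ S then (1 : ℝ) else 0) := by
    intro Z
    rw [Finset.mul_sum, Real.exp_sum]
  simp only [h1]
  have h2 := Finset.sum_pow' (Finset.univ : Finset β)
    (fun y => Real.exp (a * if y ∈ S then (1 : ℝ) else 0)) n
  have h2' : (∑ y : β, Real.exp (a * if y ∈ S then (1 : ℝ) else 0)) ^ n =
      ∑ Z : Fin n → β, ∏ j, Real.exp (a * if Z j ∈ S then (1 : ℝ) else 0) := by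
    rw [h2]; simp
  rw [← h2']
  have h3 : (∑ y : β, Real.exp (a * if y ∈ S then (1 : ℝ) else 0)) =
      Fintype.card β * (1 + unifP S * (Real.exp a - 1)) := by
    have : ∀ y : β, Real.exp (a * if y ∈ S then (1 : ℝ) else 0) =
      1 + (if y ∈ S then (1 : ℝ) else 0) * (Real.exp a - 1) := by
      intro y; split_ifs <;> simp
    simp only [this]
    rw [Finset.sum_add_distrib, ← Finset.sum_mul, unifP_eq_sum]
    simp only [Finset.sum_const, Finset.card_univ, nsmul_eq_mul]
    field_simp
  have h4 : 0 ≤ 1 + unifP S * (Real.exp a - 1) := by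
    have : 0 ≤ Fintype.card β * (1 + unifP S * (Real.exp a - 1)) := by
      rw [← h3]; positivity
    exact nonneg_of_mul_nonneg_right this hc
  rw [h3, mul_pow, Fintype.card_fun, Fintype.card_fin, Real.exp_nat_mul]
  push_cast
  gcongr
  linarith [Real.add_one_le_exp (unifP S * (Real.exp a - 1))]

lemma core_bound {β γ : Type*} [Fintype β] [Nonempty β] [Fintype γ] (n : ℕ)
    (E : Set β) (B : γ → Set β) (p a : ℝ) (ha : 0 < a) (hB : ∀ x, unifP (B x) ≤ p)
    (hp : p * Real.exp a ≤ 1) :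
    unifP {Z : Fin n → β | ∃ x, ∀ j, Z j ∈ E → Z j ∈ B x} ≤
      Real.exp (-(13 / 100) * unifP E * n) +
        Fintype.card γ * Real.exp (n - a * unifP E * n / 2) := by
  set q := unifP E with hq
  have hq0 : 0 ≤ q := unifP_nonneg E
  set cE : (Fin n → β) → ℝ := fun Z => ∑ j, if Z j ∈ E then (1 : ℝ) else 0 with hcE
  set cB : γ → (Fin n → β) → ℝ := fun x Z => ∑ j, if Z j ∈ B x then (1 : ℝ) else 0 with hcB
  have hsub : {Z : Fin n → β | ∃ x, ∀ j, Z j ∈ E → Z j ∈ B x} ⊆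
      {Z | Real.exp (-(q * n / 2)) ≤ Real.exp ((-1) * cE Z)} ∪
      {Z | ∃ x, Z ∈ {Z | Real.exp (a * (q * n / 2)) ≤ Real.exp (a * cB x Z)}} := by
    rintro Z ⟨x, hx⟩
    by_cases h : cE Z ≤ q * n / 2
    · left
      simp only [Set.mem_ofPred_eq, Real.exp_le_exp]
      linarith
    · right
      refine ⟨x, ?_⟩
      simp only [Set.mem_ofPred_eq, Real.exp_le_exp]
      have : cE Z ≤ cB x Z := by
        simp only [hcE, hcB]
        gcongr with j
        by_cases h1 : Z j ∈ E
        · simp [h1, hx j h1]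
        · simp only [h1, if_false]; positivity
      gcongr
      linarith
  refine (unifP_mono hsub).trans ((unifP_union_le _ _).trans (add_le_add ?_ ?_))
  · refine (unifP_markov _ (fun z => by positivity) _ _ (by positivity)
      (mgf_bound n E (-1)) (by positivity)).trans ?_
    rw [← Real.exp_sub, Real.exp_le_exp]
    have := Real.exp_neg_one_lt_d9
    rw [← hq]
    have h2 : 0 ≤ (n : ℝ) * q := by positivity
    nlinarith
  · refine unifP_exists_le _ _ (fun x => ?_)
    refine (unifP_markov _ (fun z => by positivity) _ _ (by positivity)
      (mgf_bound n (B x) a) (by positivity)).trans ?_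
    rw [← Real.exp_sub, Real.exp_le_exp]
    have h1 : unifP (B x) * (Real.exp a - 1) ≤ 1 := by
      have h0 := unifP_nonneg (B x)
      have := mul_le_mul_of_nonneg_right (hB x) (Real.exp_pos a).le
      linarith
    have := mul_le_mul_of_nonneg_left h1 (Nat.cast_nonneg (α := ℝ) n)
    linarith

/-! ### cube facts -/

lemma pmVal_beq (a b : Bool) : pmVal (a == b) = pmVal a * pmVal b := by
  cases a <;> cases b <;> simp [pmVal]

lemma pmVal_sq (a : Bool) : pmVal a * pmVal a = 1 := by
  cases a <;> simp [pmVal]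

lemma pmVal_not (a : Bool) : pmVal (!a) = - pmVal a := by
  cases a <;> simp [pmVal]

lemma signSwitch_invol {N : ℕ} (g x : Cube N) : signSwitch g (signSwitch g x) = x := by
  funext i
  simp only [signSwitch]
  cases g i <;> cases x i <;> rfl

def switchEquiv {N : ℕ} (g : Cube N) : Cube N ≃ Cube N :=
  ⟨signSwitch g, signSwitch g, signSwitch_invol g, signSwitch_invol g⟩

def switchEquivPi {N k : ℕ} (g : Cube N) : (Fin (k + 1) → Cube N) ≃ (Fin (k + 1) → Cube N) :=
  ⟨fun Y i => signSwitch g (Y i), fun Y i => signSwitch g (Y i),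
    fun Y => by funext i; exact signSwitch_invol g _,
    fun Y => by funext i; exact signSwitch_invol g _⟩

lemma second_moment {N : ℕ} (u : Fin N → ℝ) :
    ∑ g : Cube N, (∑ l, pmVal (g l) * u l) ^ 2 = Fintype.card (Cube N) * ∑ l, u l ^ 2 := by
  have key : ∀ l m : Fin N, l ≠ m → ∑ g : Cube N, pmVal (g l) * pmVal (g m) = 0 := by
    intro l m hlm
    let e : Cube N ≃ Cube N :=
      Function.Involutive.toPerm (fun g => Function.update g l (!g l)) (by
        intro g; funext i; by_cases h : i = l
        · subst h; simp
        · simp [h])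
    have h := e.sum_comp (fun g : Cube N => pmVal (g l) * pmVal (g m))
    have h2 : ∀ g : Cube N, pmVal (e g l) * pmVal (e g m) = -(pmVal (g l) * pmVal (g m)) := by
      intro g
      have e1 : e g l = !g l := by
        change Function.update g l (!g l) l = _
        simp
      have e2 : e g m = g m := by
        change Function.update g l (!g l) m = _
        simp [hlm.symm]
      rw [e1, e2, pmVal_not]; ring
    simp only [h2, Finset.sum_neg_distrib] at h
    linarith
  have h1 : ∀ g : Cube N, (∑ l, pmVal (g l) * u l) ^ 2 =
      ∑ l, ∑ m, (pmVal (g l) * pmVal (g m)) * (u l * u m) := by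
    intro g
    rw [sq, Finset.sum_mul_sum]
    refine Finset.sum_congr rfl fun l _ => Finset.sum_congr rfl fun m _ => by ring
  simp only [h1]
  rw [Finset.sum_comm, Finset.mul_sum]
  refine Finset.sum_congr rfl fun l _ => ?_
  rw [Finset.sum_comm]
  rw [Finset.sum_eq_single l]
  · simp only [pmVal_sq]; simp [sq]
  · intro m _ hm
    rw [← Finset.sum_mul, key l m hm.symm, zero_mul]
  · simp

lemma centralBinom_sq (m : ℕ) : Nat.centralBinom m ^ 2 * (2 * m + 1) ≤ 16 ^ m := by
  induction m with
  | zero => simp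
  | succ n ih =>
    have h := Nat.succ_mul_centralBinom_succ n
    have h3 : 0 < (n + 1) ^ 2 := by positivity
    refine Nat.le_of_mul_le_mul_left ?_ h3
    calc (n + 1) ^ 2 * (Nat.centralBinom (n + 1) ^ 2 * (2 * (n + 1) + 1))
        = ((n + 1) * Nat.centralBinom (n + 1)) ^ 2 * (2 * n + 3) := by ring
      _ = (Nat.centralBinom n ^ 2 * (2 * n + 1)) * (4 * (2 * n + 1) * (2 * n + 3)) := by
          rw [h]; ring
      _ ≤ 16 ^ n * (4 * (2 * n + 1) * (2 * n + 3)) := by gcongr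
      _ ≤ 16 ^ n * (16 * (n + 1) ^ 2) := by
          apply Nat.mul_le_mul_left
          nlinarith
      _ = (n + 1) ^ 2 * 16 ^ (n + 1) := by ring

lemma choose_mid_sq (N : ℕ) : (N.choose (N / 2)) ^ 2 * N ≤ 4 ^ N := by
  obtain ⟨m, rfl | rfl⟩ := Nat.even_or_odd' N
  · have := centralBinom_sq m
    rw [Nat.centralBinom] at this
    rw [Nat.mul_div_cancel_left m (by norm_num), pow_mul]
    norm_num
    nlinarith [sq_nonneg ((2 * m).choose m)]
  · have := centralBinom_sq (m + 1)
    have h2 : Nat.centralBinom (m + 1) = 2 * (2 * m + 1).choose m := by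
      rw [Nat.centralBinom, show 2 * (m + 1) = (2 * m + 1) + 1 by ring, Nat.choose_succ_succ,
        Nat.choose_symm_half]; ring
    have h3 : (2 * m + 1) / 2 = m := by omega
    rw [h2] at this
    rw [h3, pow_succ 4 (2 * m), pow_mul]
    norm_num
    rw [pow_succ 16 m] at this
    nlinarith [sq_nonneg ((2 * m + 1).choose m)]

lemma choose_le_real (N d : ℕ) (hN : 0 < N) :
    ((N.choose d : ℕ) : ℝ) ≤ 2 ^ N / Real.sqrt N := by
  have h1 : ((N.choose d : ℕ) : ℝ) ≤ (N.choose (N / 2) : ℕ) := by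
    exact_mod_cast Nat.choose_le_middle d N
  refine h1.trans ?_
  rw [le_div_iff₀ (by positivity)]
  refine (sq_le_sq₀ (by positivity) (by positivity)).1 ?_
  rw [mul_pow, Real.sq_sqrt (by positivity), ← pow_mul, mul_comm N 2, pow_mul]
  norm_num
  exact_mod_cast choose_mid_sq N

lemma level_count (N d : ℕ) :
    ({z : Cube N | (Finset.univ.filter (fun i => z i = true)).card = d}).ncard = N.choose d := by
  have : ({z : Cube N | (Finset.univ.filter (fun i => z i = true)).card = d}) =
      (fun s : Finset (Fin N) => (fun i => decide (i ∈ s) : Cube N)) ''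
        (Finset.powersetCard d (Finset.univ : Finset (Fin N)) : Set (Finset (Fin N))) := by
    ext z
    simp only [Set.mem_ofPred_eq, Set.mem_image, Finset.mem_coe, Finset.mem_powersetCard_univ]
    constructor
    · intro h
      refine ⟨_, h, ?_⟩
      funext i
      simp
    · rintro ⟨s, hs, rfl⟩
      simpa using hs
  rw [this, Set.ncard_image_of_injective, Set.ncard_coe_finset, Finset.card_powersetCard,
    Finset.card_univ, Fintype.card_fin]
  intro s t h
  ext i
  have := congrFun h i
  simpa using this

lemma cubeDot_eq {N : ℕ} (x y : Cube N) : cubeDot x y =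
    2 * ((Finset.univ.filter (fun i => signSwitch x y i = true)).card : ℝ) - N := by
  unfold cubeDot
  have : ∀ i, pmVal (x i) * pmVal (y i) =
      2 * (if signSwitch x y i = true then (1 : ℝ) else 0) - 1 := by
    intro i
    rw [← pmVal_beq]
    change pmVal (signSwitch x y i) = _
    generalize signSwitch x y i = b
    cases b <;> norm_num [pmVal]
  simp only [this]
  rw [Finset.sum_sub_distrib, ← Finset.mul_sum, Finset.sum_boole]
  simp

lemma window {N : ℕ} (hN : 0 < N) (x : Cube N) (a t : ℝ) (ht : 0 ≤ t) :
    unifP {y : Cube N | a ≤ cubeDot x y ∧ cubeDot x y < a + 2 * t} ≤ (t + 1) / Real.sqrt N := by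
  set b := (a + N) / 2 with hb
  have h1 : {y : Cube N | a ≤ cubeDot x y ∧ cubeDot x y < a + 2 * t} ⊆
      {y | switchEquiv x y ∈ {z : Cube N | ∃ d : Finset.Ico ⌈b⌉₊ ⌈b + t⌉₊,
        z ∈ {z : Cube N | (Finset.univ.filter (fun i => z i = true)).card = d.1}}} := by
    rintro y ⟨h1, h2⟩
    rw [cubeDot_eq] at h1 h2
    refine ⟨⟨(Finset.univ.filter (fun i => signSwitch x y i = true)).card, ?_⟩, rfl⟩
    rw [Finset.mem_Ico]
    constructor
    · rw [Nat.ceil_le]; linarith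
    · rw [Nat.lt_ceil]; linarith
  refine (unifP_mono h1).trans ?_
  rw [unifP_equiv]
  refine (unifP_exists_le _ (1 / Real.sqrt N) ?_).trans ?_
  · intro d
    unfold unifP
    rw [level_count]
    have := choose_le_real N d hN
    rw [div_le_iff₀ (by positivity)]
    simp only [Fintype.card_fun, Fintype.card_bool, Fintype.card_fin]
    push_cast
    linarith [this, show 1 / Real.sqrt N * 2 ^ N = 2 ^ N / Real.sqrt N by ring]
  · rw [Fintype.card_coe, Nat.card_Ico, mul_one_div]
    gcongr
    have h3 : ⌈b + t⌉₊ ≤ ⌈b⌉₊ + ⌈t⌉₊ := Nat.ceil_add_le b t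
    have h4 : ⌈b + t⌉₊ - ⌈b⌉₊ ≤ ⌈t⌉₊ := by omega
    have h5 := Nat.ceil_lt_add_one ht
    have h6 : ((⌈b + t⌉₊ - ⌈b⌉₊ : ℕ) : ℝ) ≤ ⌈t⌉₊ := by exact_mod_cast h4
    linarith

lemma cubeDot_switch {N : ℕ} (g y x : Cube N) :
    cubeDot (signSwitch g y) x = cubeDot (signSwitch y x) g := by
  unfold cubeDot signSwitch
  simp only [pmVal_beq]
  exact Finset.sum_congr rfl fun i _ => by ring

lemma diff_bound {N : ℕ} (x y z : Cube N) (D t : ℝ) (ht : 0 < t)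
    (hD : (hammingDist y z : ℝ) ≤ D) :
    unifP {g : Cube N | (2 * t) ^ 2 ≤
      (cubeDot (signSwitch g y) x - cubeDot (signSwitch g z) x) ^ 2} ≤ D / t ^ 2 := by
  set u : Fin N → ℝ := fun l => (pmVal (y l) - pmVal (z l)) * pmVal (x l) with hu
  have h1 : ∀ g : Cube N, cubeDot (signSwitch g y) x - cubeDot (signSwitch g z) x =
      ∑ l, pmVal (g l) * u l := by
    intro g
    unfold cubeDot signSwitch
    simp only [pmVal_beq, hu]
    rw [← Finset.sum_sub_distrib]
    exact Finset.sum_congr rfl fun i _ => by ring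
  have h2 : ∑ l, u l ^ 2 = 4 * (hammingDist y z : ℝ) := by
    have : ∀ l, u l ^ 2 = 4 * if y l ≠ z l then (1 : ℝ) else 0 := by
      intro l
      simp only [hu]
      cases y l <;> cases z l <;> cases x l <;> norm_num [pmVal]
    simp only [this]
    rw [← Finset.mul_sum, Finset.sum_boole, hammingDist]
  simp only [h1]
  refine (unifP_markov (fun g : Cube N => (∑ l, pmVal (g l) * u l) ^ 2)
    (fun g => sq_nonneg _) ((2 * t) ^ 2)
    (∑ l, u l ^ 2) (by positivity) (second_moment u).le
    (Finset.sum_nonneg fun i _ => sq_nonneg _)).trans ?_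
  rw [h2, div_le_div_iff₀ (by positivity) (by positivity)]
  nlinarith [sq_nonneg t, mul_le_mul_of_nonneg_right hD (sq_nonneg t)]

lemma bad_bound {N k : ℕ} (hN : 0 < N)
    (f : (Fin (k + 1) → Cube N) → (Fin (k + 1) → Cube N)) (D t a : ℝ) (ht : 0 < t) (hD0 : 0 ≤ D)
    (hf1 : ∀ g : Cube N, ∀ Y : Fin (k + 1) → Cube N,
      f (fun i => signSwitch g (Y i)) = fun i => signSwitch g (f Y i))
    (hf2 : ∀ Y : Fin (k + 1) → Cube N, ∀ i : Fin (k + 1), (hammingDist (Y i) (f Y i) : ℝ) ≤ D)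
    (x : Cube N) :
    unifP {Y : Fin (k + 1) → Cube N | ∃ i, cubeDot (f Y i) x < a ∧ a ≤ cubeDot (Y i) x} ≤
      ((k : ℝ) + 1) * ((t + 1) / Real.sqrt N + D / t ^ 2) := by
  have h := unifP_exists_le
    (fun i => {Y : Fin (k + 1) → Cube N | cubeDot (f Y i) x < a ∧ a ≤ cubeDot (Y i) x})
    ((t + 1) / Real.sqrt N + D / t ^ 2) ?_
  · simpa using h
  intro i
  refine unifP_average (γ := Cube N) switchEquivPi _ _ (by positivity) (fun Y => ?_)
  have hsub : {g : Cube N | switchEquivPi g Y ∈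
      {Y : Fin (k + 1) → Cube N | cubeDot (f Y i) x < a ∧ a ≤ cubeDot (Y i) x}} ⊆
      {g | a ≤ cubeDot (signSwitch (Y i) x) g ∧ cubeDot (signSwitch (Y i) x) g < a + 2 * t} ∪
      {g : Cube N | (2 * t) ^ 2 ≤
        (cubeDot (signSwitch g (Y i)) x - cubeDot (signSwitch g (f Y i)) x) ^ 2} := by
    rintro g ⟨h1, h2⟩
    simp only [switchEquivPi, Equiv.coe_fn_mk, hf1] at h1 h2
    by_cases h3 : cubeDot (signSwitch g (Y i)) x < a + 2 * t
    · left
      rw [cubeDot_switch] at h2 h3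
      exact ⟨h2, h3⟩
    · right
      simp only [Set.mem_ofPred_eq]
      have : 2 * t ≤ cubeDot (signSwitch g (Y i)) x - cubeDot (signSwitch g (f Y i)) x := by
        linarith
      gcongr
  exact (unifP_mono hsub).trans ((unifP_union_le _ _).trans
    (add_le_add (window hN _ a t ht.le) (diff_bound x _ _ D t ht (hf2 Y i))))

/-! ### analytic estimates -/

lemma p_estimate (L C K : ℝ) (hC : 0 < C) (hL : 6000000 * (1 + C) ≤ L) (hK0 : 0 ≤ K)
    (hK : K ≤ L / 2) :
    K * ((Real.exp (0.45 * L) + 1) / Real.exp (L / 2) +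
      (Real.exp (0.35 * L) * C * (Real.exp (L / 2) * Real.sqrt L)) / (Real.exp (0.45 * L)) ^ 2)
      * Real.exp (0.04 * L) ≤ 1 := by
  have hL1 : 1 ≤ L := by linarith
  have h1 : (1 + C) * L ^ 2 ≤ Real.exp (0.01 * L) := by
    have := Real.pow_div_factorial_le_exp (0.01 * L) (by positivity) 3
    refine le_trans ?_ this
    norm_num [Nat.factorial]
    nlinarith [mul_le_mul_of_nonneg_right hL (sq_nonneg L)]
  have hs : Real.sqrt L ≤ L := by
    rw [Real.sqrt_le_left (by linarith)]; nlinarith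
  have ha : (Real.exp (0.45 * L) + 1) / Real.exp (L / 2) ≤ 2 * Real.exp (-0.05 * L) := by
    rw [div_le_iff₀ (by positivity), mul_assoc, ← Real.exp_add]
    have : (1 : ℝ) ≤ Real.exp (0.45 * L) := Real.one_le_exp (by positivity)
    rw [show -0.05 * L + L / 2 = 0.45 * L by ring]
    linarith
  have hb : (Real.exp (0.35 * L) * C * (Real.exp (L / 2) * Real.sqrt L)) / (Real.exp (0.45 * L)) ^ 2
      ≤ C * L * Real.exp (-0.05 * L) := by
    rw [div_le_iff₀ (by positivity), ← Real.exp_nat_mul]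
    have e : Real.exp (-0.05 * L) * Real.exp ((2 : ℕ) * (0.45 * L)) =
        Real.exp (0.35 * L) * Real.exp (L / 2) := by
      rw [← Real.exp_add, ← Real.exp_add]; congr 1; push_cast; ring
    rw [mul_assoc (C * L), e]
    calc _ = Real.exp (0.35 * L) * Real.exp (L / 2) * C * Real.sqrt L := by ring
      _ ≤ Real.exp (0.35 * L) * Real.exp (L / 2) * C * L := by gcongr
      _ = _ := by ring
  calc _ ≤ (L / 2) * (2 * Real.exp (-0.05 * L) + C * L * Real.exp (-0.05 * L)) *
        Real.exp (0.04 * L) := by gcongr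
    _ = (L / 2) * (2 + C * L) * (Real.exp (-0.05 * L) * Real.exp (0.04 * L)) := by ring
    _ = (L / 2) * (2 + C * L) * Real.exp (-(0.01 * L)) := by
        rw [← Real.exp_add]; congr 2; ring
    _ ≤ ((1 + C) * L ^ 2) * Real.exp (-(0.01 * L)) := by
        refine mul_le_mul_of_nonneg_right ?_ (by positivity)
        nlinarith [mul_nonneg hC.le (sq_nonneg L), mul_nonneg (by linarith : (0:ℝ) ≤ L) (by linarith : (0:ℝ) ≤ L - 1)]
    _ ≤ Real.exp (0.01 * L) * Real.exp (-(0.01 * L)) := by gcongr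
    _ = 1 := by rw [← Real.exp_add]; simp

lemma final_estimate (N : ℕ) (q : ℝ) (hN : 1 ≤ N) (hL : 400 ^ 6 ≤ Real.log N)
    (hq : Real.log N ^ (-(1 : ℝ) / 3) ≤ q) :
    Real.exp (-(13 / 100) * q * Nstar N) +
      (2 : ℝ) ^ N * Real.exp (Nstar N - (0.04 * Real.log N) * q * Nstar N / 2) ≤
      Real.exp (-(1 / 10) * q * Nstar N) := by
  set L := Real.log N with hLdef
  have hL0 : 0 < L := by linarith [show (0:ℝ) < 400 ^ 6 by norm_num]
  have hL1 : (1300 : ℝ) ≤ L := by linarith [show (1300:ℝ) < 400 ^ 6 by norm_num]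
  have hNpos : (0 : ℝ) < N := by positivity
  have hLN : L ≤ N := (Real.log_le_sub_one_of_pos hNpos).trans (by linarith)
  set s := Real.sqrt L with hs
  have hs1 : 1 ≤ s := by rw [hs, Real.one_le_sqrt]; linarith
  have hss : s * s = L := Real.mul_self_sqrt hL0.le
  have hs36 : 36 ≤ s := by nlinarith
  set n : ℝ := (Nstar N : ℝ) with hn
  have hnle : n ≤ N := by
    have : n ≤ N / s := Nat.floor_le (by positivity)
    exact this.trans (div_le_self hNpos.le hs1)
  have hnge : N / (2 * s) ≤ n := by
    have : N / s < n + 1 := Nat.lt_floor_add_one _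
    have h2 : 2 ≤ N / s := by
      rw [le_div_iff₀ (by positivity)]; nlinarith
    have : N / (2 * s) = N / s / 2 := by field_simp
    linarith
  have hr : 400 ≤ L * L ^ (-(1 : ℝ) / 3) / s := by
    have : L * L ^ (-(1 : ℝ) / 3) / s = L ^ ((1 : ℝ) / 6) := by
      rw [hs, Real.sqrt_eq_rpow]
      nth_rewrite 1 [← Real.rpow_one L]
      rw [← Real.rpow_add hL0, ← Real.rpow_sub hL0]
      norm_num
    rw [this]
    calc (400 : ℝ) = ((400 : ℝ) ^ (6 : ℕ)) ^ ((1 : ℝ) / 6) := by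
          rw [← Real.rpow_natCast, ← Real.rpow_mul (by norm_num)]; norm_num
      _ ≤ _ := by gcongr
  have hq0 : 0 ≤ q := le_trans (by positivity) hq
  have hkey : 2 * N ≤ 0.01 * L * (q * n) := by
    calc (2 : ℝ) * N ≤ (0.01 * (N / 2)) * (L * L ^ (-(1 : ℝ) / 3) / s) := by nlinarith
      _ = 0.01 * L * (L ^ (-(1 : ℝ) / 3) * (N / (2 * s))) := by field_simp
      _ ≤ _ := by gcongr
  have hqn0 : 0 ≤ q * n := by positivity
  have hqn : 200 ≤ q * n := by
    have : 200 * L ≤ L * (q * n) := by linarith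
    exact le_of_mul_le_mul_left (by linarith) hL0
  have h2N : (2 : ℝ) ^ N ≤ Real.exp N := by
    rw [← Real.exp_one_rpow, Real.rpow_natCast]
    gcongr
    linarith [Real.exp_one_gt_d9]
  have hsecond : (2 : ℝ) ^ N * Real.exp (n - (0.04 * L) * q * n / 2) ≤
      Real.exp (-(13 / 100) * q * n) := by
    calc _ ≤ Real.exp N * Real.exp (n - (0.04 * L) * q * n / 2) := by gcongr
      _ ≤ _ := by
        rw [← Real.exp_add, Real.exp_le_exp]
        have : 1300 * (q * n) ≤ L * (q * n) := by gcongr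
        nlinarith
  have hlast : 2 * Real.exp (-(13 / 100) * q * n) ≤ Real.exp (-(1 / 10) * q * n) := by
    calc _ ≤ Real.exp 1 * Real.exp (-(13 / 100) * q * n) := by
          gcongr; linarith [Real.exp_one_gt_d9]
      _ ≤ _ := by
        rw [← Real.exp_add, Real.exp_le_exp]; nlinarith
  linarith

def groupEquiv (N k n : ℕ) : (Fin ((k + 1) * n) → Cube N) ≃ (Fin n → Fin (k + 1) → Cube N) where
  toFun Z := fun j i => Z (finProdFinEquiv (i, j))
  invFun W := fun m => W (finProdFinEquiv.symm m).2 (finProdFinEquiv.symm m).1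
  left_inv Z := by
    funext m
    exact congrArg Z (finProdFinEquiv.apply_symm_apply m)
  right_inv W := by
    funext j i
    simp only [Equiv.symm_apply_apply]

/-- There is an absolute constant `c > 0` such that for every `κ` and every
constant `C₂ > 0`, for all sufficiently large `N`, all `k + 1 ≤ (log N)/2`,
every gentle mapping `f` and every `A ⊆ Σ_N`: writing
`q(A) := μ(A ∩ ⋂_i H(f_i(Y)) = ∅)` for a uniform `Y ∈ Σ_N^{k+1}`, if
`q(A) ≥ (log N)^{-1/3}` then, for i.i.d. uniform `Y_1, …, Y_{(k+1)N*}`,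
`μ(A ∩ ⋂_i H(Y_i) = ∅) ≥ 1 - exp(-c q(A) N*)`. -/
theorem gentle_map_boosting :
    ∃ c > (0 : ℝ), ∀ κ C₂ : ℝ, 0 < C₂ →
      ∃ N₀ : ℕ, ∀ N : ℕ, N₀ ≤ N →
        ∀ k : ℕ, ((k : ℝ) + 1) ≤ Real.log N / 2 →
          ∀ f : (Fin (k + 1) → Cube N) → (Fin (k + 1) → Cube N), Gentle C₂ f →
            ∀ A : Set (Cube N),
              Real.log N ^ (-(1 : ℝ) / 3) ≤
                unifP {Y : Fin (k + 1) → Cube N |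
                  (A ∩ ⋂ i : Fin (k + 1), halfCube κ (f Y i)) = (∅ : Set (Cube N))} →
              unifP {Z : Fin ((k + 1) * Nstar N) → Cube N |
                  (A ∩ ⋂ i, halfCube κ (Z i)) = (∅ : Set (Cube N))} ≥
                1 - Real.exp (-c *
                    unifP {Y : Fin (k + 1) → Cube N |
                      (A ∩ ⋂ i : Fin (k + 1), halfCube κ (f Y i)) = (∅ : Set (Cube N))} *
                    Nstar N) := by
  refine ⟨1 / 10, by norm_num, fun κ C₂ hC => ?_⟩
  refine ⟨⌈Real.exp (400 ^ 6 + 6000000 * (1 + C₂))⌉₊, fun N hN k hk f hf A hq => ?_⟩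
  obtain ⟨hf1, hf2⟩ := hf
  have hN' : Real.exp (400 ^ 6 + 6000000 * (1 + C₂)) ≤ N := (Nat.le_ceil _).trans (by exact_mod_cast hN)
  have hNpos : (0 : ℝ) < N := (Real.exp_pos _).trans_le hN'
  have hN1 : 0 < N := by exact_mod_cast hNpos
  have hL : 400 ^ 6 + 6000000 * (1 + C₂) ≤ Real.log N := (Real.le_log_iff_exp_le hNpos).2 hN'
  have hLa : 400 ^ 6 ≤ Real.log N := by
    have : 0 ≤ 6000000 * (1 + C₂) := by positivity
    linarith
  have hLb : 6000000 * (1 + C₂) ≤ Real.log N := by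
    have : (0 : ℝ) ≤ 400 ^ 6 := by positivity
    linarith
  have hLpos : 0 ≤ Real.log N := le_trans (by positivity) hLa
  set E : Set (Fin (k + 1) → Cube N) := {Y : Fin (k + 1) → Cube N |
    (A ∩ ⋂ i : Fin (k + 1), halfCube κ (f Y i)) = (∅ : Set (Cube N))} with hE
  set q := unifP E with hqdef
  set L := Real.log N with hLdef
  set B : Cube N → Set (Fin (k + 1) → Cube N) := fun x =>
    {Y | ∃ i, cubeDot (f Y i) x < κ * Real.sqrt N ∧ κ * Real.sqrt N ≤ cubeDot (Y i) x} with hB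
  have hsqrtN : Real.sqrt N = Real.exp (L / 2) := by
    rw [Real.sqrt_eq_rpow, Real.rpow_def_of_pos hNpos]; congr 1; ring
  have htwo : (2 : ℝ) ^ (k + 1) ≤ Real.exp (0.35 * L) := by
    rw [← Real.exp_log (show (0 : ℝ) < 2 by norm_num), ← Real.exp_nat_mul, Real.exp_le_exp]
    have := Real.log_two_lt_d9
    push_cast
    have hk0 : (0 : ℝ) ≤ (k : ℝ) + 1 := by positivity
    nlinarith
  have hBp : ∀ x, unifP (B x) ≤ ((k : ℝ) + 1) * ((Real.exp (0.45 * L) + 1) / Real.exp (L / 2) +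
      (Real.exp (0.35 * L) * C₂ * (Real.exp (L / 2) * Real.sqrt L)) / (Real.exp (0.45 * L)) ^ 2) := by
    intro x
    have := bad_bound hN1 f (Real.exp (0.35 * L) * C₂ * (Real.exp (L / 2) * Real.sqrt L))
      (Real.exp (0.45 * L)) (κ * Real.sqrt N) (by positivity) (by positivity) hf1 ?_ x
    · rw [← hsqrtN] at this ⊢
      exact this
    · intro Y i
      refine (hf2 Y i).trans ?_
      rw [Real.sqrt_mul hNpos.le, hsqrtN]
      gcongr
  have hp := p_estimate L C₂ (k + 1) hC hLb (by positivity) hk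
  have hcore := core_bound (Nstar N) E B _ (0.04 * L)
    (by have : (0:ℝ) < 400 ^ 6 := by positivity
        linarith) hBp hp
  have hfin := final_estimate N q hN1 hLa hq
  have hcard : (Fintype.card (Cube N) : ℝ) = 2 ^ N := by
    simp
  rw [hcard] at hcore
  rw [unifP_compl]
  have hsub : {Z : Fin ((k + 1) * Nstar N) → Cube N |
      (A ∩ ⋂ i, halfCube κ (Z i)) = (∅ : Set (Cube N))}ᶜ ⊆
      {Z | groupEquiv N k (Nstar N) Z ∈
        {W : Fin (Nstar N) → Fin (k + 1) → Cube N | ∃ x, ∀ j, W j ∈ E → W j ∈ B x}} := by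
    intro Z hZ
    obtain ⟨x, hxA, hxZ⟩ := Set.nonempty_iff_ne_empty.2 hZ
    refine ⟨x, fun j hj => ?_⟩
    rw [Set.mem_iInter] at hxZ
    by_contra hcon
    have hmem : x ∈ (A ∩ ⋂ i : Fin (k + 1),
        halfCube κ (f (groupEquiv N k (Nstar N) Z j) i)) := by
      refine ⟨hxA, Set.mem_iInter.2 fun i => ?_⟩
      by_contra hi
      refine hcon ⟨i, not_le.1 hi, ?_⟩
      exact hxZ (finProdFinEquiv (i, j))
    rw [hj] at hmem
    exact hmem
  have h1 := unifP_mono hsub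
  rw [unifP_equiv] at h1
  have h2 := h1.trans (hcore.trans hfin)
  linarith
end
end

section
/- For every κ ∈ ℝ there exist constants C₃, c > 0 depending only on κ such that for all sufficiently large N: if Y_1, …, Y_{⌊C₃N⌋} are i.i.d. uniform random vectors in Σ_N, then the probability that ⋂_{i=1}^{⌊C₃N⌋} H(Y_i) is nonempty is at most e^{-cN}. -/
open scoped Classical

noncomputable section


lemma mgf_cube {N : ℕ} (t : ℝ) (x : Cube N) :
    ∑ y : Cube N, Real.exp (-t * cubeDot y x) = 2 ^ N * Real.cosh t ^ N := by
  have h1 : ∀ y : Cube N, Real.exp (-t * cubeDot y x)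
      = ∏ i, Real.exp (-t * (pmVal (y i) * pmVal (x i))) := by
    intro y
    rw [← Real.exp_sum, cubeDot, Finset.mul_sum]
  simp_rw [h1]
  have h2 := Finset.prod_univ_sum (fun _ : Fin N => (Finset.univ : Finset Bool))
    (fun i b => Real.exp (-t * (pmVal b * pmVal (x i))))
  rw [Fintype.piFinset_univ] at h2
  rw [← h2]
  have h3 : ∀ i : Fin N, ∑ b : Bool, Real.exp (-t * (pmVal b * pmVal (x i)))
      = 2 * Real.cosh t := by
    intro i
    rw [Real.cosh_eq]
    cases x i <;> simp [pmVal] <;> ring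
  simp_rw [h3]
  simp [mul_pow]

lemma cosh_lower (t : ℝ) (ht : t ^ 2 ≤ 1) : Real.exp (t ^ 2 / 4) ≤ Real.cosh t := by
  have h1 : 1 + t ^ 2 / 2 ≤ Real.cosh t := by
    have := Real.cosh_sq' (t / 2)
    have h2 : Real.cosh t = 2 * Real.sinh (t / 2) ^ 2 + 1 := by
      have := Real.cosh_two_mul (t / 2)
      rw [show 2 * (t / 2) = t by ring] at this
      rw [this, Real.cosh_sq]; ring
    have h3 : (t / 2) ^ 2 ≤ Real.sinh (t / 2) ^ 2 := by
      rcases le_total 0 (t / 2) with h | h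
      · have := Real.self_le_sinh_iff.2 h
        nlinarith
      · have := Real.sinh_le_self_iff.2 h
        nlinarith
    nlinarith
  have h0 := sq_nonneg t
  set u := t ^ 2 / 4 with hu
  have h4 : 1 - u ≤ Real.exp (-u) := Real.one_sub_le_exp_neg u
  have h5 : Real.exp u * Real.exp (-u) = 1 := by rw [← Real.exp_add]; simp
  have h6 : Real.exp u ≤ 1 + 2 * u := by
    have hp := Real.exp_pos u
    have h7 : Real.exp u * (1 - u) ≤ 1 := by nlinarith
    have h8 : 1 ≤ (1 + 2 * u) * (1 - u) := by nlinarith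
    by_contra hc
    push Not at hc
    nlinarith
  linarith

lemma halfcube_card (κ l : ℝ) (hl : l = 4 * |κ| + 4) (N : ℕ) (hN : 1 ≤ N) (hN2 : l ^ 2 ≤ N)
    (x : Cube N) :
    ((Finset.univ.filter (fun y : Cube N => x ∈ halfCube κ y)).card : ℝ)
      ≤ (1 - 1 / (4 * Real.exp (2 * l ^ 2))) * 2 ^ N := by
  have hNpos : (0 : ℝ) < N := by exact_mod_cast hN
  have hs : 0 < Real.sqrt N := Real.sqrt_pos.2 hNpos
  have hss : Real.sqrt N ^ 2 = N := Real.sq_sqrt hNpos.le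
  have hl4 : 4 ≤ l := by rw [hl]; linarith [abs_nonneg κ]
  set t := l / Real.sqrt N with ht
  have hts : t * Real.sqrt N = l := by rw [ht]; field_simp
  have ht2 : t ^ 2 * N = l ^ 2 := by rw [← hss, ← hts]; ring
  have ht0 : 0 < t := by positivity
  have ht1 : t ^ 2 ≤ 1 := by
    by_contra hc
    push Not at hc
    nlinarith
  set a : ℝ := 2 * Real.exp (2 * l ^ 2) with ha
  have hapos : 0 < a := by positivity
  set M : ℝ := Real.exp (l * |κ|) with hM
  have hpt : ∀ y : Cube N, Real.exp (-t * cubeDot y x) ≤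
      M + Real.exp (-(2 * t) * cubeDot y x) / (2 * a)
        + a / 2 * (1 - if x ∈ halfCube κ y then 1 else 0) := by
    intro y
    have hsq : Real.exp (-(2 * t) * cubeDot y x) = Real.exp (-t * cubeDot y x) ^ 2 := by
      rw [← Real.exp_nat_mul]; congr 1; push_cast; ring
    rw [hsq]
    set Z := Real.exp (-t * cubeDot y x) with hZ
    have hMp : 0 < M := Real.exp_pos _
    split_ifs with h
    · have h' : κ * Real.sqrt N ≤ cubeDot y x := h
      have : Z ≤ M := by
        apply Real.exp_le_exp.2
        have h1 := mul_le_mul_of_nonneg_left h' ht0.le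
        have h2 : t * (κ * Real.sqrt N) = l * κ := by rw [← hts]; ring
        have h3 := neg_abs_le κ
        nlinarith
      have : 0 ≤ Z ^ 2 / (2 * a) := by positivity
      linarith
    · have : Z ^ 2 / (2 * a) + a / 2 - Z = (Z - a) ^ 2 / (2 * a) := by field_simp; ring
      have : 0 ≤ (Z - a) ^ 2 / (2 * a) := by positivity
      linarith
  have hsum := Finset.sum_le_sum (fun y (_ : y ∈ (Finset.univ : Finset (Cube N))) => hpt y)
  rw [Finset.sum_add_distrib, Finset.sum_add_distrib, ← Finset.sum_div, ← Finset.mul_sum,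
    Finset.sum_sub_distrib, Finset.sum_boole, mgf_cube, mgf_cube] at hsum
  simp only [Finset.sum_const, Finset.card_univ, Fintype.card_fun, Fintype.card_bool,
    Fintype.card_fin, nsmul_eq_mul, mul_one] at hsum
  push_cast at hsum
  set c : ℝ := ((Finset.univ.filter (fun y : Cube N => x ∈ halfCube κ y)).card : ℝ)
  have hE : Real.exp (l ^ 2 / 4) ≤ Real.cosh t ^ N := by
    calc Real.exp (l ^ 2 / 4) = Real.exp (t ^ 2 / 4) ^ N := by
          rw [← Real.exp_nat_mul, ← ht2]; congr 1; ring
      _ ≤ _ := pow_le_pow_left₀ (Real.exp_pos _).le (cosh_lower t ht1) N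
  have hE2 : Real.cosh (2 * t) ^ N ≤ Real.exp (2 * l ^ 2) := by
    calc Real.cosh (2 * t) ^ N ≤ Real.exp ((2 * t) ^ 2 / 2) ^ N :=
          pow_le_pow_left₀ (Real.cosh_pos _).le (Real.cosh_le_exp_half_sq _) N
      _ = _ := by rw [← Real.exp_nat_mul, ← ht2]; congr 1; ring
  have hM2 : 2 * M ≤ Real.exp (l ^ 2 / 4) := by
    have : l ^ 2 / 4 = l + l * |κ| := by rw [hl]; ring
    rw [this, Real.exp_add]
    have h2 : 2 ≤ Real.exp l := by linarith [Real.add_one_le_exp l]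
    exact mul_le_mul_of_nonneg_right h2 (Real.exp_pos _).le
  have hM1 : 1 ≤ M := Real.one_le_exp (by positivity)
  have hP : (0 : ℝ) < 2 ^ N := by positivity
  set P : ℝ := 2 ^ N
  have hA : P * Real.cosh (2 * t) ^ N / (2 * a) ≤ P / 4 := by
    rw [div_le_iff₀ (by positivity)]
    have : P / 4 * (2 * a) = P * Real.exp (2 * l ^ 2) := by rw [ha]; ring
    rw [this]
    exact mul_le_mul_of_nonneg_left hE2 hP.le
  have hB : P * (2 * M) ≤ P * Real.cosh t ^ N :=
    mul_le_mul_of_nonneg_left (hM2.trans hE) hP.le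
  have hC : P * 1 ≤ P * M := mul_le_mul_of_nonneg_left hM1 hP.le
  have hD : P / 2 ≤ a * (P - c) := by nlinarith
  have hF : 1 / (4 * Real.exp (2 * l ^ 2)) = 1 / (2 * a) := by rw [ha]; ring
  rw [hF]
  have hG : P / (2 * a) ≤ P - c := by
    rw [div_le_iff₀ (by positivity)]; linarith
  have : (1 - 1 / (2 * a)) * P = P - P / (2 * a) := by ring
  linarith

theorem intersection_empty_whp (κ : ℝ) :
    ∃ C₃ > (0 : ℝ), ∃ c > (0 : ℝ), ∃ N₀ : ℕ, ∀ N : ℕ, N₀ ≤ N →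
      unifP {Y : Fin ⌊C₃ * (N : ℝ)⌋₊ → Cube N |
          (⋂ i, halfCube κ (Y i)).Nonempty} ≤ Real.exp (-c * N) := by
  obtain ⟨l, hl⟩ : ∃ l : ℝ, l = 4 * |κ| + 4 := ⟨_, rfl⟩
  obtain ⟨d, hd⟩ : ∃ d : ℝ, d = 1 / (4 * Real.exp (2 * l ^ 2)) := ⟨_, rfl⟩
  have hd0 : 0 < d := by rw [hd]; positivity
  have hd1 : d ≤ 1 := by
    rw [hd, div_le_one (by positivity)]
    have : 1 ≤ Real.exp (2 * l ^ 2) := Real.one_le_exp (by positivity)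
    linarith
  refine ⟨3 / d, by positivity, 1, one_pos, ⌈l ^ 2⌉₊ + 1, ?_⟩
  intro N hN
  have hN1 : 1 ≤ N := by omega
  have hN1' : (1 : ℝ) ≤ N := by exact_mod_cast hN1
  have hN2 : l ^ 2 ≤ N := (Nat.le_ceil _).trans (by exact_mod_cast (by omega : ⌈l ^ 2⌉₊ ≤ N))
  have hm : 3 / d * N - 1 ≤ (⌊3 / d * (N : ℝ)⌋₊ : ℝ) := (Nat.sub_one_lt_floor _).le
  generalize ⌊3 / d * (N : ℝ)⌋₊ = m at hm ⊢
  have hcard : (Set.ncard {Y : Fin m → Cube N | (⋂ i, halfCube κ (Y i)).Nonempty} : ℝ)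
      ≤ 2 ^ N * ((1 - d) * 2 ^ N) ^ m := by
    let A : Cube N → Finset (Cube N) := fun x =>
      Finset.univ.filter (fun y : Cube N => x ∈ halfCube κ y)
    have hsub : {Y : Fin m → Cube N | (⋂ i, halfCube κ (Y i)).Nonempty} ⊆
        ((Finset.univ.biUnion fun x => Fintype.piFinset (fun _ : Fin m => A x) :
          Finset (Fin m → Cube N)) : Set (Fin m → Cube N)) := by
      rintro Y ⟨x, hx⟩
      have hx' := Set.mem_iInter.1 hx
      rw [Finset.mem_coe, Finset.mem_biUnion]
      refine ⟨x, Finset.mem_univ _, ?_⟩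
      rw [Fintype.mem_piFinset]
      intro i
      exact Finset.mem_filter.2 ⟨Finset.mem_univ _, hx' i⟩
    have h1 := Set.ncard_le_ncard hsub (Finset.finite_toSet _)
    rw [Set.ncard_coe_finset] at h1
    have h2 := h1.trans Finset.card_biUnion_le
    have h3 : (Set.ncard {Y : Fin m → Cube N | (⋂ i, halfCube κ (Y i)).Nonempty} : ℝ)
        ≤ ∑ x : Cube N, ((A x).card : ℝ) ^ m := by
      refine (Nat.cast_le.2 h2).trans (le_of_eq ?_)
      push_cast
      simp
    refine h3.trans ?_
    calc ∑ x : Cube N, ((A x).card : ℝ) ^ m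
        ≤ ∑ x : Cube N, ((1 - d) * 2 ^ N) ^ m := by
          refine Finset.sum_le_sum fun x _ => ?_
          refine pow_le_pow_left₀ (Nat.cast_nonneg _) ?_ m
          rw [hd]
          exact halfcube_card κ l hl N hN1 hN2 x
      _ = _ := by simp
  unfold unifP
  have hct : (Fintype.card (Fin m → Cube N) : ℝ) = (2 ^ N) ^ m := by simp
  rw [hct, div_le_iff₀ (by positivity)]
  refine hcard.trans ?_
  rw [mul_pow, ← mul_assoc]
  refine mul_le_mul_of_nonneg_right ?_ (by positivity)
  have e1 : (2 : ℝ) ^ N ≤ Real.exp N := by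
    rw [← Real.exp_one_pow]
    exact pow_le_pow_left₀ (by norm_num) (by linarith [Real.add_one_le_exp (1 : ℝ)]) N
  have e2 : (1 - d) ^ m ≤ Real.exp (-(d * m)) := by
    calc (1 - d) ^ m ≤ Real.exp (-d) ^ m :=
          pow_le_pow_left₀ (by linarith) (Real.one_sub_le_exp_neg d) m
      _ = _ := by rw [← Real.exp_nat_mul]; congr 1; ring
  calc (2 : ℝ) ^ N * (1 - d) ^ m ≤ Real.exp N * Real.exp (-(d * m)) :=
        mul_le_mul e1 e2 (pow_nonneg (by linarith) _) (Real.exp_pos _).le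
    _ = Real.exp (N + -(d * m)) := (Real.exp_add _ _).symm
    _ ≤ _ := by
      apply Real.exp_le_exp.2
      have h := mul_le_mul_of_nonneg_left hm hd0.le
      have h' : d * (3 / d * N - 1) = 3 * N - d := by field_simp
      linarith
end
end

section
/- For every κ ∈ ℝ there exist constants c₄, c > 0 depending only on κ such that for all sufficiently large N: if Y_1, …, Y_{⌊c₄N⌋} are i.i.d. uniform random vectors in Σ_N, then the probability that ⋂_{i=1}^{⌊c₄N⌋} H(Y_i) is nonempty is at least 1 − e^{-cN}. -/
open scoped Classical

noncomputable section


lemma sum_bool_prod {R : Type*} [CommSemiring R] {β : Type*} [Fintype β] [DecidableEq β] (f : β → Bool → R) :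
    ∑ x : β → Bool, ∏ i, f i (x i) = ∏ i, (f i true + f i false) := by
  have h := Finset.prod_univ_sum (fun _ : β => (Finset.univ : Finset Bool)) f
  rw [Fintype.piFinset_univ] at h
  rw [← h]
  simp

lemma geom_int (r : ℝ) (h0 : 0 < r) (h1 : r ≤ 1/2) (s : Finset ℤ) :
    ∑ a ∈ s, r ^ a.natAbs ≤ 1 + 4 * r := by
  have e1 : HasSum (fun n : ℕ => r ^ (n : ℤ).natAbs) (1 - r)⁻¹ := by
    simpa using hasSum_geometric_of_lt_one h0.le (by linarith)
  have e2 : HasSum (fun n : ℕ => r ^ (-((n : ℤ) + 1)).natAbs) (r * (1 - r)⁻¹) := by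
    have := (hasSum_geometric_of_lt_one h0.le (by linarith : r < 1)).mul_left r
    refine this.congr_fun ?_ |> fun h => h
    intro n
    have : (-((n : ℤ) + 1)).natAbs = n + 1 := by omega
    rw [this, pow_succ]; ring
  have e := HasSum.of_nat_of_neg_add_one (f := fun a : ℤ => r ^ a.natAbs) e1 e2
  refine (sum_le_hasSum s (fun i _ => by positivity) e).trans ?_
  have h2 : 0 < 1 - r := by linarith
  have : (1 - r)⁻¹ + r * (1 - r)⁻¹ = (1 + r) / (1 - r) := by field_simp
  rw [this, div_le_iff₀ h2]
  nlinarith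

lemma count_int {ι : Type*} [Fintype ι] (F : Finset (ι → ℤ)) (r T : ℝ) (h0 : 0 < r)
    (h1 : r ≤ 1/2) (hF : ∀ z ∈ F, ∑ i, (|z i| : ℝ) ≤ T) :
    (F.card : ℝ) ≤ Real.exp (T / r) * Real.exp (4 * r * Fintype.card ι) := by
  have hr : Real.exp (-(1 / r)) ≤ r := by
    have h := Real.add_one_le_exp (1 / r)
    rw [Real.exp_neg, inv_le_comm₀ (Real.exp_pos _) h0]
    rw [one_div] at h ⊢
    linarith
  have key : ∀ z ∈ F, Real.exp (-(T / r)) ≤ ∏ i, r ^ (z i).natAbs := by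
    intro z hz
    calc Real.exp (-(T / r)) ≤ Real.exp (-((∑ i, (|z i| : ℝ)) / r)) := by
          apply Real.exp_le_exp.2
          have := hF z hz
          gcongr
      _ = ∏ i, (Real.exp (-(1 / r))) ^ (z i).natAbs := by
          rw [Finset.sum_div, ← Finset.sum_neg_distrib, Real.exp_sum]
          apply Finset.prod_congr rfl
          intro i _
          rw [← Real.exp_nat_mul]
          congr 1
          have : ((z i).natAbs : ℝ) = |(z i : ℝ)| := by
            rw [Nat.cast_natAbs]; simp
          rw [this]; ring
      _ ≤ _ := by
          apply Finset.prod_le_prod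
          · intros; positivity
          · intros; gcongr
  have hsub : F ⊆ Fintype.piFinset (fun i => F.image (fun z => z i)) := by
    intro z hz
    rw [Fintype.mem_piFinset]
    intro i
    exact Finset.mem_image_of_mem _ hz
  have h2 : (F.card : ℝ) * Real.exp (-(T / r)) ≤ Real.exp (4 * r * Fintype.card ι) := by
    calc (F.card : ℝ) * Real.exp (-(T / r)) = ∑ z ∈ F, Real.exp (-(T / r)) := by simp
      _ ≤ ∑ z ∈ F, ∏ i, r ^ (z i).natAbs := Finset.sum_le_sum key
      _ ≤ ∑ z ∈ Fintype.piFinset (fun i => F.image (fun z => z i)), ∏ i, r ^ (z i).natAbs :=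
          Finset.sum_le_sum_of_subset_of_nonneg hsub (fun _ _ _ => by positivity)
      _ = ∏ i, ∑ a ∈ F.image (fun z => z i), r ^ a.natAbs := by
          rw [Finset.prod_univ_sum]
      _ ≤ ∏ _i : ι, Real.exp (4 * r) := by
          apply Finset.prod_le_prod
          · intros; positivity
          · intro i _
            refine (geom_int r h0 h1 _).trans ?_
            linarith [Real.add_one_le_exp (4 * r)]
      _ = _ := by
          rw [Finset.prod_const, ← Real.exp_nat_mul, Finset.card_univ]; ring_nf
  rw [Real.exp_neg, ← div_eq_mul_inv, div_le_iff₀ (Real.exp_pos _)] at h2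
  linarith

lemma ball_count {β : Type*} [Fintype β] (x₀ : β → Bool) (F : Finset (β → Bool))
    (hF : ∀ x ∈ F, (hammingDist x₀ x : ℝ) ≤ (Fintype.card β : ℝ) / 10) :
    (F.card : ℝ) ≤ Real.exp (0.34 * Fintype.card β) := by
  set n : ℝ := (Fintype.card β : ℝ) with hn
  have e2 : Real.exp (-2) ≤ 0.14 := by
    rw [Real.exp_neg, inv_le_comm₀ (Real.exp_pos _) (by norm_num)]
    have : Real.exp 2 = Real.exp 1 * Real.exp 1 := by rw [← Real.exp_add]; norm_num
    rw [this]
    have := Real.exp_one_gt_d9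
    nlinarith
  have h2 : (F.card : ℝ) * Real.exp (-(0.2 * n)) ≤ Real.exp (0.14 * n) := by
    calc (F.card : ℝ) * Real.exp (-(0.2 * n)) = ∑ z ∈ F, Real.exp (-(0.2 * n)) := by simp
      _ ≤ ∑ z ∈ F, ∏ i, (if x₀ i = z i then 1 else Real.exp (-2)) := by
          apply Finset.sum_le_sum
          intro z hz
          have h := hF z hz
          rw [Finset.prod_ite, Finset.prod_const_one, one_mul, Finset.prod_const,
            ← Real.exp_nat_mul]
          apply Real.exp_le_exp.2
          have : (hammingDist x₀ z : ℝ) = ((Finset.univ.filter (fun i => ¬ x₀ i = z i)).card : ℝ) := by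
            unfold hammingDist
            norm_cast
          rw [← this]
          linarith
      _ ≤ ∑ z : β → Bool, ∏ i, (if x₀ i = z i then 1 else Real.exp (-2)) :=
          Finset.sum_le_sum_of_subset_of_nonneg (Finset.subset_univ _)
            (fun _ _ _ => Finset.prod_nonneg (fun _ _ => by split_ifs <;> positivity))
      _ = ∏ i : β, (1 + Real.exp (-2)) := by
          rw [sum_bool_prod (fun i b => if x₀ i = b then (1:ℝ) else Real.exp (-2))]
          apply Finset.prod_congr rfl
          intro i _
          cases x₀ i <;> simp [add_comm]
      _ ≤ ∏ _i : β, Real.exp 0.14 := by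
          apply Finset.prod_le_prod
          · intros; positivity
          · intro i _
            linarith [Real.add_one_le_exp 0.14]
      _ = _ := by
          rw [Finset.prod_const, ← Real.exp_nat_mul, Finset.card_univ, ← hn]; ring_nf
  rw [Real.exp_neg, ← div_eq_mul_inv, div_le_iff₀ (Real.exp_pos _), ← Real.exp_add] at h2
  refine h2.trans (le_of_eq ?_)
  ring_nf

lemma cosh_sum {β : Type*} [Fintype β] [DecidableEq β] (a : β → ℝ) :
    ∑ x : β → Bool, Real.exp (∑ j, a j * pmVal (x j)) ≤
      2 ^ (Fintype.card β) * Real.exp ((∑ j, a j ^ 2) / 2) := by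
  have h1 : ∑ x : β → Bool, Real.exp (∑ j, a j * pmVal (x j)) = ∏ j, (2 * Real.cosh (a j)) := by
    simp_rw [Real.exp_sum]
    rw [sum_bool_prod (fun j b => Real.exp (a j * pmVal b))]
    apply Finset.prod_congr rfl
    intro i _
    rw [Real.cosh_eq]
    simp [pmVal]
    ring
  rw [h1, Finset.prod_mul_distrib, Finset.prod_const, Finset.card_univ, Finset.sum_div, Real.exp_sum]
  gcongr with j
  exact Real.cosh_le_exp_half_sq _

lemma round_pow_le (x : ℝ) : (|(round x : ℤ)| : ℝ) ≤ (2 * |x|) ^ 8 := by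
  have h := abs_sub_round x
  by_cases hx : |x| < 1/2
  · have : round x = 0 := by
      rw [round_eq_zero_iff]
      rw [abs_lt] at hx
      constructor <;> linarith
    rw [this]; simp
  · push Not at hx
    have h3 : |(round x : ℝ)| ≤ 2 * |x| := by
      have : |(round x : ℝ)| ≤ |x| + |x - round x| := by
        have := abs_sub_abs_le_abs_sub (round x : ℝ) x
        rw [abs_sub_comm] at this
        linarith
      linarith
    have h4 : (1:ℝ) ≤ 2 * |x| := by linarith
    exact h3.trans (le_self_pow₀ h4 (by norm_num))

lemma pow8_le (x : ℝ) : x ^ 8 ≤ 40320 * (Real.exp x + Real.exp (-x)) := by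
  have h := Real.pow_div_factorial_le_exp |x| (abs_nonneg x) 8
  have h2 : Real.exp |x| ≤ Real.exp x + Real.exp (-x) := by
    rcases abs_cases x with ⟨h, _⟩ | ⟨h, _⟩ <;> rw [h] <;> linarith [Real.exp_pos x, Real.exp_pos (-x)]
  have h3 : |x| ^ 8 = x ^ 8 := by
    rw [Even.pow_abs]; decide
  rw [h3] at h
  have : ((Nat.factorial 8 : ℕ) : ℝ) = 40320 := by norm_num [Nat.factorial]
  rw [this] at h
  linarith

lemma partial_col {ι β : Type} [Fintype ι] [Fintype β] (A : ι → β → ℝ) (hA : ∀ i j, |A i j| ≤ 1)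
    (N : ℕ) (hι : Fintype.card ι ≤ N) (hβ : Fintype.card β ≤ N) (hn : 0 < Fintype.card β) :
    ∃ χ : β → ℝ, (∀ j, χ j = 0 ∨ χ j = 1 ∨ χ j = -1) ∧
      (Fintype.card {j // χ j = 0} : ℝ) ≤ 0.9 * (Fintype.card β : ℝ) ∧
      ∀ i, |∑ j, A i j * χ j| ≤ 20 * √√((Fintype.card β : ℝ) * N) := by
  set nn := Fintype.card β with hnn
  set n : ℝ := (nn : ℝ) with hnr
  have hn1 : (1:ℝ) ≤ n := by rw [hnr]; exact_mod_cast hn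
  have hN : n ≤ N := by rw [hnr]; exact_mod_cast hβ
  have hNpos : (0:ℝ) < N := by linarith
  set s : ℝ := √√(n * N) with hs
  have hs4 : s ^ 4 = n * N := by
    have : s ^ 4 = (s ^ 2) ^ 2 := by ring
    rw [this, hs, Real.sq_sqrt (Real.sqrt_nonneg _), Real.sq_sqrt (by positivity)]
  have hspos : 0 < s := by rw [hs]; positivity
  have hs1 : 1 ≤ s := by
    rw [hs, Real.one_le_sqrt, Real.one_le_sqrt]; nlinarith
  by_cases hsmall : n ≤ 20
  · refine ⟨fun _ => 1, by simp, ?_, ?_⟩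
    · simp; linarith
    · intro i
      calc |∑ j, A i j * 1| ≤ ∑ j, |A i j * 1| := Finset.abs_sum_le_sum_abs _ _
        _ ≤ ∑ j : β, (1:ℝ) := Finset.sum_le_sum (fun j _ => by simpa using hA i j)
        _ = n := by simp [hnr, hnn]
        _ ≤ _ := by linarith
  push Not at hsmall
  set X : ι → (β → Bool) → ℝ := fun i x => ∑ j, A i j * pmVal (x j) with hX
  set W : ℝ := 40 * s with hW
  have hWpos : 0 < W := by positivity
  set b : (β → Bool) → ι → ℤ := fun x i => round (X i x / W) with hb
  set T : ℝ := 0.00001 * n ^ 2 / N with hT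
  have hTpos : 0 < T := by positivity
  -- pointwise bound
  have hpt : ∀ x i, (|b x i| : ℝ) ≤ 0.0000016 * n ^ 2 / N ^ 2 *
      (Real.exp (X i x / √n) + Real.exp (-(X i x / √n))) := by
    intro x i
    refine (round_pow_le _).trans ?_
    have h8 := pow8_le (X i x / √n)
    have e1 : (2 * |X i x / W|) ^ 8 = 256 * (X i x) ^ 8 / W ^ 8 := by
      rw [mul_pow, Even.pow_abs (by decide), div_pow]; ring
    have e2 : W ^ 8 = 40 ^ 8 * (n * N) ^ 2 := by
      rw [hW, ← hs4]; ring
    have e3 : (X i x / √n) ^ 8 = (X i x) ^ 8 / n ^ 4 := by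
      rw [div_pow]
      congr 1
      have : (√n) ^ 8 = ((√n) ^ 2) ^ 4 := by ring
      rw [this, Real.sq_sqrt (by linarith)]
    rw [e3] at h8
    rw [e1, e2]
    have e4 : 256 * X i x ^ 8 / (40 ^ 8 * (n * N) ^ 2) =
        (256 / 40 ^ 8) * (n ^ 2 / N ^ 2) * (X i x ^ 8 / n ^ 4) := by
      field_simp
    rw [e4]
    set E := Real.exp (X i x / √n) + Real.exp (-(X i x / √n)) with hE
    have hEp : 0 < E := by positivity
    calc (256 / 40 ^ 8) * ((n:ℝ) ^ 2 / N ^ 2) * (X i x ^ 8 / n ^ 4)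
        ≤ (256 / 40 ^ 8) * (n ^ 2 / N ^ 2) * (40320 * E) := by gcongr
      _ = (256 / 40 ^ 8 * 40320) * ((n ^ 2 / N ^ 2) * E) := by ring
      _ ≤ 0.0000016 * ((n ^ 2 / N ^ 2) * E) := by
          gcongr; norm_num
      _ = _ := by ring
  have hexp : ∀ i (c : ℝ), c ^ 2 = 1 → ∑ x : β → Bool, Real.exp (c * (X i x / √n)) ≤ 2 ^ nn * 1.7 := by
    intro i c hc
    have h := cosh_sum (fun j => c * A i j / √n)
    have e : ∀ x : β → Bool, ∑ j, c * A i j / √n * pmVal (x j) = c * (X i x / √n) := by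
      intro x
      rw [hX]
      simp only
      rw [Finset.sum_div, Finset.mul_sum]
      apply Finset.sum_congr rfl
      intros; ring
    simp_rw [e] at h
    refine h.trans ?_
    have h1 : ∑ j, (c * A i j / √n) ^ 2 ≤ 1 := by
      calc ∑ j, (c * A i j / √n) ^ 2 ≤ ∑ j : β, 1 / n := by
            apply Finset.sum_le_sum
            intro j _
            rw [div_pow, mul_pow, hc, Real.sq_sqrt (by linarith), one_mul]
            have : A i j ^ 2 ≤ 1 := by rw [← sq_abs]; exact pow_le_one₀ (abs_nonneg _) (hA i j)
            gcongr
        _ = 1 := by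
            simp [← hnn]
            rw [← hnr]; field_simp
    have h2 : Real.exp ((∑ j, (c * A i j / √n) ^ 2) / 2) ≤ 1.7 := by
      refine (Real.exp_le_exp.2 (by linarith : _ ≤ (1/2:ℝ))).trans ?_
      have h3 : Real.exp (1/2) * Real.exp (1/2) = Real.exp 1 := by rw [← Real.exp_add]; norm_num
      have := Real.exp_one_lt_d9
      nlinarith [Real.exp_pos (1/2)]
    rw [← hnn]
    gcongr
  have hE : ∑ x : β → Bool, ∑ i, (|b x i| : ℝ) ≤ 2 ^ nn * (T * 0.6) := by
    rw [Finset.sum_comm]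
    calc ∑ i, ∑ x : β → Bool, (|b x i| : ℝ)
        ≤ ∑ i : ι, (0.0000016 * n ^ 2 / N ^ 2 * (2 ^ nn * 3.4)) := by
          apply Finset.sum_le_sum
          intro i _
          calc ∑ x : β → Bool, (|b x i| : ℝ) ≤ ∑ x : β → Bool, 0.0000016 * n ^ 2 / N ^ 2 *
              (Real.exp (X i x / √n) + Real.exp (-(X i x / √n))) :=
                Finset.sum_le_sum (fun x _ => hpt x i)
            _ ≤ _ := by
                rw [← Finset.mul_sum, Finset.sum_add_distrib]
                have h1 := hexp i 1 (by norm_num)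
                have h2 := hexp i (-1) (by norm_num)
                simp only [one_mul, neg_one_mul] at h1 h2
                gcongr
                linarith
      _ = (Fintype.card ι : ℝ) * (0.0000016 * n ^ 2 / N ^ 2 * (2 ^ nn * 3.4)) := by simp
      _ ≤ N * (0.0000016 * n ^ 2 / N ^ 2 * (2 ^ nn * 3.4)) := by gcongr
      _ = 2 ^ nn * (n ^ 2 / N * (0.0000016 * 3.4)) := by field_simp
      _ ≤ 2 ^ nn * (n ^ 2 / N * 0.000006) := by gcongr; norm_num
      _ = _ := by rw [hT]; ring
  set G : Finset (β → Bool) := Finset.univ.filter (fun x => ∑ i, (|b x i| : ℝ) ≤ T) with hG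
  have hGcard : (2:ℝ) ^ nn * 0.4 ≤ G.card := by
    have h1 : ((Finset.univ.filter (fun x => ¬ ∑ i, (|b x i| : ℝ) ≤ T)).card : ℝ) * T ≤
        2 ^ nn * (T * 0.6) := by
      refine le_trans ?_ hE
      rw [← nsmul_eq_mul]
      refine (Finset.card_nsmul_le_sum _ (fun x => ∑ i, (|b x i| : ℝ)) T ?_).trans ?_
      · intro x hx
        rw [Finset.mem_filter] at hx
        exact (not_le.1 hx.2).le
      · exact Finset.sum_le_sum_of_subset_of_nonneg (Finset.filter_subset _ _)
          (fun _ _ _ => Finset.sum_nonneg (fun _ _ => abs_nonneg _))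
    have h2 := Finset.card_filter_add_card_filter_not (s := (Finset.univ : Finset (β → Bool)))
      (fun x => ∑ i, (|b x i| : ℝ) ≤ T)
    have h3 : (Finset.univ : Finset (β → Bool)).card = 2 ^ nn := by simp [hnn]
    rw [h3] at h2
    have h4 : (G.card : ℝ) + ((Finset.univ.filter (fun x => ¬ ∑ i, (|b x i| : ℝ) ≤ T)).card : ℝ) =
      2 ^ nn := by
      rw [hG]; exact_mod_cast h2
    have h5 : ((Finset.univ.filter (fun x => ¬ ∑ i, (|b x i| : ℝ) ≤ T)).card : ℝ) ≤ 2 ^ nn * 0.6 := by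
      rw [← mul_assoc, mul_right_comm] at h1
      exact le_of_mul_le_mul_right h1 hTpos
    linarith
  have himg : ((G.image b).card : ℝ) ≤ Real.exp (0.014 * n) := by
    have h := count_int (G.image b) (n / (400 * N)) T (by positivity)
      (by rw [div_le_iff₀ (by positivity)]; linarith)
      (by
        intro z hz
        obtain ⟨x, hx, rfl⟩ := Finset.mem_image.1 hz
        exact (Finset.mem_filter.1 hx).2)
    refine h.trans ?_
    rw [← Real.exp_add]
    apply Real.exp_le_exp.2
    have e1 : T / (n / (400 * N)) = 0.004 * n := by
      rw [hT]; field_simp; norm_num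
    have e2 : 4 * (n / (400 * N)) * (Fintype.card ι : ℝ) ≤ 4 * (n / (400 * N)) * N := by gcongr
    have e3 : 4 * (n / (400 * N)) * N = 0.01 * n := by field_simp; norm_num
    rw [e1]; linarith
  have hex : ∃ x ∈ G, ∃ y ∈ G, b x = b y ∧ n / 10 < hammingDist x y := by
    by_contra hcon
    push Not at hcon
    have h := Finset.card_le_mul_card_image (f := b) G ⌊Real.exp (0.34 * n)⌋₊ (by
      intro z hz
      obtain ⟨x, hx, rfl⟩ := Finset.mem_image.1 hz
      apply Nat.le_floor
      apply ball_count x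
      intro y hy
      rw [Finset.mem_filter] at hy
      exact hcon x hx y hy.1 hy.2.symm)
    have h1 : (G.card : ℝ) ≤ Real.exp (0.34 * n) * Real.exp (0.014 * n) := by
      calc (G.card : ℝ) ≤ (⌊Real.exp (0.34 * n)⌋₊ : ℝ) * ((G.image b).card : ℝ) := by exact_mod_cast h
        _ ≤ _ := by
          gcongr
          exact Nat.floor_le (Real.exp_pos _).le
    rw [← Real.exp_add] at h1
    have h2 : (2:ℝ) ^ nn = Real.exp (n * Real.log 2) := by
      rw [hnr, Real.exp_nat_mul, Real.exp_log (by norm_num)]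
    have h3 := hGcard.trans h1
    rw [h2] at h3
    have h4 : Real.exp (-1) ≤ 0.4 := by
      rw [Real.exp_neg, inv_le_comm₀ (Real.exp_pos _) (by norm_num)]
      have := Real.exp_one_gt_d9
      norm_num; linarith
    have h5 : Real.exp (n * Real.log 2 + (-1)) ≤ Real.exp (0.34 * n + 0.014 * n) := by
      rw [Real.exp_add]
      refine le_trans ?_ h3
      gcongr
    have h6 := Real.exp_le_exp.1 h5
    have := Real.log_two_gt_d9
    nlinarith
  obtain ⟨x, -, y, -, hxy, hd⟩ := hex
  refine ⟨fun j => (pmVal (x j) - pmVal (y j)) / 2, ?_, ?_, ?_⟩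
  · intro j
    show (pmVal (x j) - pmVal (y j)) / 2 = 0 ∨ (pmVal (x j) - pmVal (y j)) / 2 = 1 ∨
      (pmVal (x j) - pmVal (y j)) / 2 = -1
    generalize x j = p
    generalize y j = q
    cases p <;> cases q <;> norm_num [pmVal]
  · have h0 : Fintype.card {j // (pmVal (x j) - pmVal (y j)) / 2 = 0} + hammingDist x y = nn := by
      rw [Fintype.card_subtype, hammingDist, hnn, ← Finset.card_univ,
        ← Finset.card_filter_add_card_filter_not (s := (Finset.univ : Finset β))
          (fun j => (pmVal (x j) - pmVal (y j)) / 2 = 0)]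
      congr 1
      apply congrArg
      ext j
      simp only [Finset.mem_filter, Finset.mem_univ, true_and]
      generalize x j = p
      generalize y j = q
      cases p <;> cases q <;> norm_num [pmVal]
    have h1 : (Fintype.card {j // (pmVal (x j) - pmVal (y j)) / 2 = 0} : ℝ) + hammingDist x y = n := by
      rw [hnr]; exact_mod_cast h0
    linarith
  · intro i
    have e : ∑ j, A i j * ((pmVal (x j) - pmVal (y j)) / 2) = (X i x - X i y) / 2 := by
      simp only [hX]
      rw [← Finset.sum_sub_distrib, Finset.sum_div]
      apply Finset.sum_congr rfl
      intros; ring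
    rw [e]
    have h1 := abs_sub_round (X i x / W)
    have h2 := abs_sub_round (X i y / W)
    have h3 : round (X i x / W) = round (X i y / W) := congrFun hxy i
    rw [h3] at h1
    have h4 : |X i x / W - X i y / W| ≤ 1 := by
      rw [abs_le] at *
      constructor <;> linarith
    rw [← sub_div, abs_div, abs_of_pos hWpos, div_le_one hWpos] at h4
    rw [abs_div, abs_of_pos (by norm_num : (0:ℝ) < 2)]
    rw [hW] at h4
    linarith

lemma full_col {ι : Type} [Fintype ι] (N : ℕ) (hι : Fintype.card ι ≤ N) (n : ℕ) :
    ∀ (β : Type) [Fintype β] (A : ι → β → ℝ), (∀ i j, |A i j| ≤ 1) → Fintype.card β = n → n ≤ N →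
    ∃ χ : β → ℝ, (∀ j, χ j = 1 ∨ χ j = -1) ∧
      ∀ i, |∑ j, A i j * χ j| ≤ 1000 * √√((n : ℝ) * N) := by
  induction n using Nat.strong_induction_on with
  | _ n ih =>
  intro β _ A hA hβ hnN
  rcases Nat.eq_zero_or_pos n with h0 | hpos
  · have : IsEmpty β := Fintype.card_eq_zero_iff.1 (hβ.trans h0)
    refine ⟨fun _ => 1, by simp, ?_⟩
    intro i
    rw [Finset.univ_eq_empty, Finset.sum_empty, abs_zero]
    positivity
  obtain ⟨χ, h1, h2, h3⟩ := partial_col A hA N hι (hβ.trans_le hnN) (by omega)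
  rw [hβ] at h2 h3
  have hnr : (0:ℝ) < n := by exact_mod_cast hpos
  have hlt : Fintype.card {j // χ j = 0} < n := by
    have : (Fintype.card {j // χ j = 0} : ℝ) < n := by linarith
    exact_mod_cast this
  obtain ⟨ψ, p1, p2⟩ := ih _ hlt {j // χ j = 0} (fun i j => A i j) (fun i j => hA i j) rfl
    (hlt.le.trans hnN)
  refine ⟨fun j => if h : χ j = 0 then ψ ⟨j, h⟩ else χ j, ?_, ?_⟩
  · intro j
    by_cases h : χ j = 0
    · simp only [h, dite_true]; exact p1 _
    · simp only [h, dite_false]; exact (h1 j).resolve_left h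
  · intro i
    have e : ∑ j, A i j * (if h : χ j = 0 then ψ ⟨j, h⟩ else χ j) =
        ∑ j : {j // χ j = 0}, A i j * ψ j + ∑ j, A i j * χ j := by
      rw [← Fintype.sum_subtype_add_sum_subtype (fun j => χ j = 0)
        (fun j => A i j * (if h : χ j = 0 then ψ ⟨j, h⟩ else χ j)),
        ← Fintype.sum_subtype_add_sum_subtype (fun j => χ j = 0) (fun j => A i j * χ j)]
      have z : ∑ j : {j // χ j = 0}, A i j * χ j = 0 :=
        Finset.sum_eq_zero (fun j _ => by rw [j.2, mul_zero])
      rw [z, zero_add]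
      congr 1
      · apply Finset.sum_congr rfl
        intro j _
        rw [dif_pos j.2]
      · apply Finset.sum_congr rfl
        intro j _
        rw [dif_neg j.2]
    rw [e]
    have b1 := p2 i
    have b2 := h3 i
    have b3 : √√((Fintype.card {j // χ j = 0} : ℝ) * N) ≤ 0.98 * √√((n:ℝ) * N) := by
      have : (0.98:ℝ) = √√(0.98 ^ 4) := by
        rw [show (0.98:ℝ)^4 = ((0.98)^2)^2 by norm_num, Real.sqrt_sq (by norm_num), Real.sqrt_sq (by norm_num)]
      rw [this, ← Real.sqrt_mul (by positivity), ← Real.sqrt_mul (by positivity), ← mul_assoc]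
      apply Real.sqrt_le_sqrt
      apply Real.sqrt_le_sqrt
      gcongr
      refine h2.trans ?_
      gcongr
      norm_num
    refine (abs_add_le _ _).trans ?_
    linarith

lemma subset_col {ι : Type} [Fintype ι] (N : ℕ) (hι : Fintype.card ι ≤ N)
    (A : ι → Fin N → ℝ) (hA : ∀ i j, |A i j| ≤ 1) (p : Fin N → Prop) :
    ∃ χ : Fin N → ℤ, (∀ j, p j → χ j = 1 ∨ χ j = -1) ∧ (∀ j, ¬ p j → χ j = 0) ∧
      ∀ i, |∑ j, A i j * χ j| ≤ 1000 * √N := by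
  have hc : Fintype.card {j // p j} ≤ N := by
    simpa using Fintype.card_subtype_le p
  obtain ⟨ψ, p1, p2⟩ := full_col N hι _ {j // p j} (fun i j => A i j) (fun i j => hA i j) rfl hc
  refine ⟨fun j => if h : p j then (if ψ ⟨j, h⟩ = 1 then 1 else -1) else 0, ?_, ?_, ?_⟩
  · intro j h
    simp only [h, dite_true]
    split_ifs <;> simp
  · intro j h
    simp [h]
  · intro i
    have e : ∑ j, A i j * ((if h : p j then (if ψ ⟨j, h⟩ = 1 then 1 else -1) else 0 : ℤ) : ℝ) =
        ∑ j : {j // p j}, A i j * ψ j := by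
      rw [← Fintype.sum_subtype_add_sum_subtype p]
      have z : ∑ j : {j // ¬ p j}, A i j * ((if h : p j then (if ψ ⟨j, h⟩ = 1 then 1 else -1) else 0 : ℤ) : ℝ) = 0 :=
        Finset.sum_eq_zero (fun j _ => by rw [dif_neg j.2]; simp)
      rw [z, add_zero]
      apply Finset.sum_congr rfl
      intro j _
      rw [dif_pos j.2]
      congr 1
      rcases p1 j with h | h
      · rw [if_pos h, h]; simp
      · rw [if_neg (by rw [h]; norm_num), h]; simp
    rw [e]
    refine (p2 i).trans ?_
    gcongr
    rw [Real.sqrt_le_left (by positivity)]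
    calc (Fintype.card {j // p j} : ℝ) * N ≤ (N:ℝ) * N := by gcongr
      _ = (N:ℝ) ^ 2 := by ring

lemma lin_disc {ι : Type} [Fintype ι] (N : ℕ) (hι : Fintype.card ι ≤ N)
    (A : ι → Fin N → ℝ) (hA : ∀ i j, |A i j| ≤ 1) (k : ℕ) :
    ∀ z : Fin N → ℤ, (∀ j, 0 ≤ z j ∧ z j ≤ 2 ^ k) → ∃ b : Fin N → ℤ, (∀ j, b j = 0 ∨ b j = 1) ∧
      ∀ i, |∑ j, A i j * ((z j : ℝ) - 2 ^ k * b j)| ≤ (2 ^ k - 1) * (1000 * √N) := by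
  induction k with
  | zero =>
    intro z hz
    refine ⟨z, fun j => ?_, fun i => ?_⟩
    · have := hz j
      simp at this
      omega
    · simp
  | succ k ih =>
    intro z hz
    obtain ⟨χ, h1, h2, h3⟩ := subset_col N hι A hA (fun j => Odd (z j))
    have hw : ∀ j, ∃ w : ℤ, z j + χ j = 2 * w ∧ 0 ≤ w ∧ w ≤ 2 ^ k := by
      intro j
      have hzj := hz j
      rw [pow_succ] at hzj
      by_cases ho : Odd (z j)
      · obtain ⟨t, ht⟩ := ho
        rcases h1 j ⟨t, ht⟩ with h | h
        · exact ⟨t + 1, by omega, by omega, by omega⟩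
        · exact ⟨t, by omega, by omega, by omega⟩
      · rw [h2 j ho]
        obtain ⟨t, ht⟩ := Int.not_odd_iff_even.1 ho
        exact ⟨t, by omega, by omega, by omega⟩
    choose w hw1 hw2 hw3 using hw
    obtain ⟨b, hb1, hb2⟩ := ih w (fun j => ⟨hw2 j, hw3 j⟩)
    refine ⟨b, hb1, fun i => ?_⟩
    have e : ∑ j, A i j * ((z j : ℝ) - 2 ^ (k+1) * b j) =
        2 * ∑ j, A i j * ((w j : ℝ) - 2 ^ k * b j) - ∑ j, A i j * χ j := by
      rw [Finset.mul_sum, ← Finset.sum_sub_distrib]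
      apply Finset.sum_congr rfl
      intro j _
      have : (z j : ℝ) = 2 * w j - χ j := by
        have := hw1 j
        have h : z j = 2 * w j - χ j := by omega
        rw [h]; push_cast; ring
      rw [this, pow_succ]; ring
    rw [e]
    have a1 := hb2 i
    have a2 := h3 i
    refine (abs_sub _ _).trans ?_
    rw [abs_mul, abs_of_pos (by norm_num : (0:ℝ) < 2), pow_succ]
    nlinarith

lemma rounding {ι : Type} [Fintype ι] (N : ℕ) (hι : Fintype.card ι ≤ N)
    (A : ι → Fin N → ℝ) (hA : ∀ i j, |A i j| ≤ 1) (x : Fin N → ℝ) (hx : ∀ j, |x j| ≤ 1) :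
    ∃ y : Cube N, ∀ i, |∑ j, A i j * x j - ∑ j, A i j * pmVal (y j)| ≤ 2 + 2000 * √N := by
  set P : ℝ := 2 ^ N with hP
  have hPpos : 0 < P := by positivity
  set z : Fin N → ℤ := fun j => ⌊P * ((x j + 1) / 2)⌋ with hz
  obtain ⟨b, hb1, hb2⟩ := lin_disc N hι A hA N z (by
    intro j
    have := abs_le.1 (hx j)
    constructor
    · apply Int.floor_nonneg.2
      apply mul_nonneg hPpos.le; linarith
    · have : (z j : ℝ) ≤ P := by
        refine (Int.floor_le _).trans ?_
        nlinarith
      rw [hP] at this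
      exact_mod_cast this)
  refine ⟨fun j => decide (b j = 1), fun i => ?_⟩
  have e : ∑ j, A i j * x j - ∑ j, A i j * pmVal (decide (b j = 1)) =
      (2 / P) * (∑ j, A i j * (P * ((x j + 1) / 2) - z j) + ∑ j, A i j * ((z j : ℝ) - P * b j)) := by
    rw [← Finset.sum_sub_distrib, ← Finset.sum_add_distrib, Finset.mul_sum]
    apply Finset.sum_congr rfl
    intro j _
    have : pmVal (decide (b j = 1)) = 2 * b j - 1 := by
      rcases hb1 j with h | h <;> rw [h] <;> norm_num [pmVal]
    rw [this]
    field_simp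
    ring
  rw [e, abs_mul, abs_of_pos (by positivity)]
  have h1 : |∑ j, A i j * (P * ((x j + 1) / 2) - z j)| ≤ P := by
    calc _ ≤ ∑ j, |A i j * (P * ((x j + 1) / 2) - z j)| := Finset.abs_sum_le_sum_abs _ _
      _ ≤ ∑ j : Fin N, (1:ℝ) := by
          apply Finset.sum_le_sum
          intro j _
          rw [abs_mul]
          apply mul_le_one₀ (hA i j) (abs_nonneg _)
          have f1 := Int.floor_le (P * ((x j + 1) / 2))
          have f2 := Int.lt_floor_add_one (P * ((x j + 1) / 2))
          rw [abs_le]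
          constructor <;> simp only [hz] <;> linarith
      _ = N := by simp
      _ ≤ P := by rw [hP]; exact_mod_cast Nat.lt_two_pow_self.le
  have h2 := hb2 i
  have h3 : |∑ j, A i j * (P * ((x j + 1) / 2) - z j) + ∑ j, A i j * ((z j : ℝ) - P * b j)| ≤
      P + P * (1000 * √N) := by
    refine (abs_add_le _ _).trans ?_
    have : (P - 1) * (1000 * √N) ≤ P * (1000 * √N) := by
      gcongr; linarith
    linarith
  calc _ ≤ 2 / P * (P + P * (1000 * √N)) := by gcongr
    _ = _ := by field_simp; ring

lemma sum_cos {ι : Type*} [Fintype ι] [DecidableEq ι] (a : ι → ℝ) :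
    ∑ y : ι → Bool, Real.cos (∑ i, a i * pmVal (y i)) =
      2 ^ (Fintype.card ι) * ∏ i, Real.cos (a i) := by
  have h := sum_bool_prod (fun (i : ι) (b : Bool) => Complex.exp ((a i * pmVal b : ℝ) * Complex.I))
  have e : ∏ i, (Complex.exp ((a i * pmVal true : ℝ) * Complex.I) +
      Complex.exp ((a i * pmVal false : ℝ) * Complex.I)) =
      ((2 ^ (Fintype.card ι) * ∏ i, Real.cos (a i) : ℝ) : ℂ) := by
    rw [← Finset.card_univ, ← Finset.prod_const, ← Finset.prod_mul_distrib]
    push_cast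
    apply Finset.prod_congr rfl
    intro i _
    rw [Complex.two_cos]
    simp [pmVal]
  rw [e] at h
  have h2 := congrArg Complex.re h
  rw [Complex.ofReal_re, Complex.re_sum] at h2
  rw [← h2]
  apply Finset.sum_congr rfl
  intro y _
  rw [← Complex.exp_sum, ← Finset.sum_mul, ← Complex.ofReal_sum, Complex.exp_ofReal_mul_I_re]

lemma exp_abs_le (u : ℝ) : Real.exp (-|u|) ≤ 3 / 4 + Real.cos u / 4 := by
  set v := (1 - Real.cos u) / 2 with hv
  have h1 := Real.abs_cos_sub_cos_le u 0
  rw [Real.cos_zero, sub_zero, abs_sub_comm] at h1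
  have h2 := (le_abs_self _).trans h1
  have h3 := Real.cos_le_one u
  have h4 := Real.neg_one_le_cos u
  have hv0 : 0 ≤ v := by rw [hv]; linarith
  have hv1 : v ≤ 1 := by rw [hv]; linarith
  have h5 : Real.exp (-|u|) ≤ Real.exp (-v) := by
    apply Real.exp_le_exp.2
    have := abs_nonneg u
    rw [hv]; linarith
  refine h5.trans ?_
  have h6 : Real.exp (-v) ≤ 1 - v / 2 := by
    rw [Real.exp_neg]
    have := Real.add_one_le_exp v
    calc (Real.exp v)⁻¹ ≤ (v + 1)⁻¹ := by gcongr
      _ ≤ _ := by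
        rw [inv_le_iff_one_le_mul₀ (by linarith)]
        nlinarith
  refine h6.trans (le_of_eq ?_)
  rw [hv]; ring

lemma small_ball {ι : Type*} [Fintype ι] [DecidableEq ι] (a : ι → ℝ) (ha : ∀ i, |a i| ≤ 1)
    (hs : 1 / 2 ≤ ∑ i, a i ^ 2) :
    ∑ y : ι → Bool, Real.exp (-|∑ i, a i * pmVal (y i)|) ≤
      2 ^ (Fintype.card ι) * Real.exp (-(0.045)) := by
  have hp : ∏ i, Real.cos (a i) ≤ 0.82 := by
    calc ∏ i, Real.cos (a i) ≤ ∏ i, Real.exp (-(0.4 * a i ^ 2)) := by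
          apply Finset.prod_le_prod
          · intro i _
            exact (Real.cos_pos_of_le_one (ha i)).le
          · intro i _
            have h := (abs_le.1 (Real.cos_bound (ha i))).2
            have h2 : |a i| ^ 4 ≤ a i ^ 2 := by
              rw [← sq_abs (a i)]
              exact pow_le_pow_of_le_one (abs_nonneg _) (ha i) (by norm_num)
            have h3 := Real.add_one_le_exp (-(0.4 * a i ^ 2))
            nlinarith [sq_nonneg (a i)]
      _ = Real.exp (-(0.4 * ∑ i, a i ^ 2)) := by
          rw [← Real.exp_sum, Finset.mul_sum, Finset.sum_neg_distrib]
      _ ≤ Real.exp (-(0.2)) := by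
          apply Real.exp_le_exp.2
          linarith
      _ ≤ 0.82 := by
          rw [Real.exp_neg, inv_le_comm₀ (Real.exp_pos _) (by norm_num)]
          have := Real.quadratic_le_exp_of_nonneg (by norm_num : (0:ℝ) ≤ 0.2)
          refine le_trans ?_ this
          norm_num
  calc ∑ y : ι → Bool, Real.exp (-|∑ i, a i * pmVal (y i)|)
      ≤ ∑ y : ι → Bool, (3 / 4 + Real.cos (∑ i, a i * pmVal (y i)) / 4) :=
        Finset.sum_le_sum (fun y _ => exp_abs_le _)
    _ = 2 ^ (Fintype.card ι) * (3 / 4 + (∏ i, Real.cos (a i)) / 4) := by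
        rw [Finset.sum_add_distrib, ← Finset.sum_div Finset.univ (fun y : ι → Bool => Real.cos (∑ i, a i * pmVal (y i))), sum_cos]
        simp
        ring
    _ ≤ _ := by
        gcongr
        have := Real.add_one_le_exp (-(0.045:ℝ))
        linarith

lemma net_prob {M N : ℕ} (a : Fin M → ℝ) (ha : ∀ i, |a i| ≤ 1)
    (hs : 1 / 2 ≤ ∑ i, a i ^ 2) :
    ∑ Y : Fin M → Cube N, Real.exp (-∑ j, |∑ i, a i * pmVal (Y i j)|) ≤
      2 ^ (M * N) * Real.exp (-(0.045 * N)) := by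
  have h1 : ∑ Y : Fin M → Cube N, Real.exp (-∑ j, |∑ i, a i * pmVal (Y i j)|) =
      (∑ y : Fin M → Bool, Real.exp (-|∑ i, a i * pmVal (y i)|)) ^ N := by
    rw [Fintype.sum_pow]
    refine Fintype.sum_equiv (Equiv.piComm (fun _ _ => Bool)) _ _ ?_
    intro Y
    rw [← Finset.sum_neg_distrib, Real.exp_sum]
    rfl
  rw [h1]
  have h2 := small_ball a ha hs
  calc _ ≤ (2 ^ (Fintype.card (Fin M)) * Real.exp (-(0.045))) ^ N := by
        gcongr
    _ = _ := by
        rw [mul_pow, ← pow_mul, ← Real.exp_nat_mul, Fintype.card_fin]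
        congr 2; ring

lemma sign_prob {M N : ℕ} (s : ℝ) (σ : Fin M → Bool) (τ : Fin N → Bool) :
    ∑ Y : Fin M → Cube N, Real.exp (s * ∑ i, ∑ j, pmVal (σ i) * pmVal (τ j) * pmVal (Y i j)) ≤
      2 ^ (M * N) * Real.exp (s ^ 2 * (M * N) / 2) := by
  have hsq : ∀ b, pmVal b ^ 2 = 1 := by intro b; cases b <;> norm_num [pmVal]
  have h := cosh_sum (β := Fin M × Fin N) (fun p => s * (pmVal (σ p.1) * pmVal (τ p.2)))
  have e : ∑ p : Fin M × Fin N, (s * (pmVal (σ p.1) * pmVal (τ p.2))) ^ 2 = s ^ 2 * (M * N) := by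
    simp_rw [mul_pow, hsq]
    simp
    ring
  rw [e, Fintype.card_prod, Fintype.card_fin, Fintype.card_fin] at h
  refine le_trans (le_of_eq ?_) h
  refine Fintype.sum_equiv (Equiv.curry (Fin M) (Fin N) Bool).symm
    (fun Y : Fin M → Fin N → Bool =>
      Real.exp (s * ∑ i, ∑ j, pmVal (σ i) * pmVal (τ j) * pmVal (Y i j)))
    (fun x : Fin M × Fin N → Bool =>
      Real.exp (∑ p : Fin M × Fin N, s * (pmVal (σ p.1) * pmVal (τ p.2)) * pmVal (x p))) ?_
  intro Y
  congr 1
  rw [Fintype.sum_prod_type, Finset.mul_sum]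
  apply Finset.sum_congr rfl
  intro i _
  rw [Finset.mul_sum]
  apply Finset.sum_congr rfl
  intro j _
  simp [Equiv.curry]
  ring

def GoodY {M N : ℕ} (Y : Fin M → Cube N) : Prop :=
  ∀ l : Fin M → ℝ, N * √(∑ i, l i ^ 2) ≤ 100 * ∑ j, |∑ i, l i * pmVal (Y i j)|

def netZ (M : ℕ) : Finset (Fin M → ℤ) :=
  (Fintype.piFinset (fun _ => Finset.Icc (-(201 * M : ℤ)) (201 * M))).filter (fun z =>
    ∑ i, (|z i| : ℝ) ≤ 201 * M ∧ (∀ i, |(z i : ℝ) / (201 * √M)| ≤ 1) ∧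
      1 / 2 ≤ ∑ i, ((z i : ℝ) / (201 * √M)) ^ 2)

lemma pm_sign (u : ℝ) : ∃ b, pmVal b * u = |u| := by
  rcases le_total 0 u with h | h
  · exact ⟨true, by simp [pmVal, abs_of_nonneg h]⟩
  · exact ⟨false, by simp [pmVal, abs_of_nonpos h]⟩

lemma l1_le {M N : ℕ} (Y : Fin M → Cube N) (B : ℝ)
    (h : ∀ (σ : Fin M → Bool) (τ : Fin N → Bool),
      ∑ i, ∑ j, pmVal (σ i) * pmVal (τ j) * pmVal (Y i j) ≤ B)
    (e : Fin M → ℝ) (he : ∀ i, |e i| ≤ 1) : ∑ j, |∑ i, e i * pmVal (Y i j)| ≤ B := by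
  choose τ hτ using fun j => pm_sign (∑ i, e i * pmVal (Y i j))
  choose σ hσ using fun i => pm_sign (∑ j, pmVal (τ j) * pmVal (Y i j))
  refine le_trans ?_ (h σ τ)
  calc ∑ j, |∑ i, e i * pmVal (Y i j)| = ∑ j, pmVal (τ j) * ∑ i, e i * pmVal (Y i j) := by
        simp_rw [hτ]
    _ = ∑ i, e i * ∑ j, pmVal (τ j) * pmVal (Y i j) := by
        simp_rw [Finset.mul_sum]
        rw [Finset.sum_comm]
        apply Finset.sum_congr rfl
        intro i _
        apply Finset.sum_congr rfl
        intros; ring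
    _ ≤ ∑ i, |∑ j, pmVal (τ j) * pmVal (Y i j)| := by
        apply Finset.sum_le_sum
        intro i _
        refine (le_abs_self _).trans ?_
        rw [abs_mul]
        exact mul_le_of_le_one_left (abs_nonneg _) (he i)
    _ = _ := by
        simp_rw [← hσ, Finset.mul_sum, mul_assoc]

lemma good_of {M N : ℕ} (hM : 1 ≤ M) (Y : Fin M → Cube N)
    (h1 : ∀ z ∈ netZ M, (N : ℝ) / 50 ≤ ∑ j, |∑ i, ((z i : ℝ) / (201 * √M)) * pmVal (Y i j)|)
    (h2 : ∀ (σ : Fin M → Bool) (τ : Fin N → Bool),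
      ∑ i, ∑ j, pmVal (σ i) * pmVal (τ j) * pmVal (Y i j) ≤ 2 * N * √M) : GoodY Y := by
  intro l₀
  have hMr : (1:ℝ) ≤ M := by exact_mod_cast hM
  have hsM : 0 < √(M:ℝ) := by positivity
  have hsq : √(M:ℝ) ^ 2 = M := Real.sq_sqrt (by positivity)
  set q := √(∑ i, l₀ i ^ 2) with hq
  have hq2 : q ^ 2 = ∑ i, l₀ i ^ 2 := Real.sq_sqrt (Finset.sum_nonneg (fun _ _ => sq_nonneg _))
  rcases (Real.sqrt_nonneg (∑ i, l₀ i ^ 2)).eq_or_lt with h0 | hqpos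
  · rw [hq, ← h0, mul_zero]; positivity
  rw [← hq] at hqpos
  set t := 200 * √M / q with ht
  have htpos : 0 < t := by positivity
  set l : Fin M → ℝ := fun i => t * l₀ i with hl
  have hl2 : ∑ i, l i ^ 2 = 40000 * M := by
    simp only [hl, mul_pow]
    rw [← Finset.mul_sum, ← hq2, ht, div_pow, mul_pow, hsq]
    field_simp; norm_num
  set z : Fin M → ℤ := fun i => round (l i) with hz
  have hr : ∀ i, |l i - z i| ≤ 1 := fun i => (abs_sub_round (l i)).trans (by norm_num)
  have hli : ∀ i, |l i| ≤ 200 * √M := by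
    intro i
    apply abs_le_of_sq_le_sq _ (by positivity)
    rw [mul_pow 200, hsq]
    have := Finset.single_le_sum (f := fun i => l i ^ 2) (fun i _ => sq_nonneg _) (Finset.mem_univ i)
    linarith
  have hzi : ∀ i, |(z i : ℝ)| ≤ |l i| + 1 := by
    intro i
    have := abs_sub_abs_le_abs_sub (z i : ℝ) (l i)
    rw [abs_sub_comm] at this
    linarith [hr i]
  have hsum : ∑ i, (|z i| : ℝ) ≤ 201 * M := by
    have hcs : ∑ i, |l i| ≤ 200 * M := by
      apply le_of_sq_le_sq _ (by positivity)
      have := sq_sum_le_card_mul_sum_sq (s := (Finset.univ : Finset (Fin M))) (f := fun i => |l i|)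
      simp only [sq_abs, hl2, Finset.card_univ, Fintype.card_fin] at this
      nlinarith
    calc ∑ i, (|z i| : ℝ) ≤ ∑ i, (|l i| + 1) := Finset.sum_le_sum (fun i _ => hzi i)
      _ = ∑ i, |l i| + M := by rw [Finset.sum_add_distrib]; simp
      _ ≤ _ := by linarith
  have hone : 1 ≤ √(M:ℝ) := by rw [Real.one_le_sqrt]; exact hMr
  have hmem : z ∈ netZ M := by
    rw [netZ, Finset.mem_filter, Fintype.mem_piFinset]
    refine ⟨?_, hsum, ?_, ?_⟩
    · intro i
      rw [Finset.mem_Icc, ← abs_le]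
      have := Finset.single_le_sum (f := fun i => (|z i| : ℝ)) (fun i _ => abs_nonneg _) (Finset.mem_univ i)
      have h3 := this.trans hsum
      exact_mod_cast h3
    · intro i
      rw [abs_div, abs_of_pos (by positivity : 0 < 201 * √(M:ℝ)), div_le_one (by positivity)]
      linarith [hzi i, hli i]
    · simp_rw [div_pow]
      rw [← Finset.sum_div, mul_pow, hsq, le_div_iff₀ (by positivity)]
      have : ∑ i, ((3/4) * l i ^ 2 - 3) ≤ ∑ i, (z i : ℝ) ^ 2 := by
        apply Finset.sum_le_sum
        intro i _
        have h := abs_le.1 (hr i)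
        have h' : (l i - z i) ^ 2 ≤ 1 := by nlinarith
        nlinarith [sq_nonneg (l i / 2 - 2 * (l i - z i))]
      rw [Finset.sum_sub_distrib, ← Finset.mul_sum, hl2] at this
      simp at this
      linarith
  have k1 := h1 z hmem
  have k2 := l1_le Y _ h2 (fun i => z i - l i) (fun i => by rw [abs_sub_comm]; exact hr i)
  have k3 : ∑ j, |∑ i, ((z i : ℝ) / (201 * √M)) * pmVal (Y i j)| =
      (∑ j, |∑ i, (z i : ℝ) * pmVal (Y i j)|) / (201 * √M) := by
    rw [Finset.sum_div]
    apply Finset.sum_congr rfl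
    intro j _
    rw [← abs_of_pos (by positivity : 0 < 201 * √(M:ℝ)), ← abs_div, Finset.sum_div,
      abs_of_pos (by positivity : 0 < 201 * √(M:ℝ))]
    congr 1
    apply Finset.sum_congr rfl
    intros; ring
  rw [k3, le_div_iff₀ (by positivity)] at k1
  have k4 : ∑ j, |∑ i, (z i : ℝ) * pmVal (Y i j)| ≤
      ∑ j, |∑ i, ((z i : ℝ) - l i) * pmVal (Y i j)| + ∑ j, |∑ i, l i * pmVal (Y i j)| := by
    rw [← Finset.sum_add_distrib]
    apply Finset.sum_le_sum
    intro j _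
    refine le_trans (le_of_eq ?_) (abs_add_le _ _)
    rw [← Finset.sum_add_distrib]
    congr 1
    apply Finset.sum_congr rfl
    intros; ring
  have k5 : ∑ j, |∑ i, l i * pmVal (Y i j)| = t * ∑ j, |∑ i, l₀ i * pmVal (Y i j)| := by
    rw [Finset.mul_sum]
    apply Finset.sum_congr rfl
    intro j _
    conv_rhs => rw [← abs_of_pos htpos, ← abs_mul, Finset.mul_sum]
    congr 1
    apply Finset.sum_congr rfl
    intros; simp only [hl]; ring
  set S := ∑ j, |∑ i, l₀ i * pmVal (Y i j)| with hS
  have k6 : 2 * N * √M ≤ t * S := by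
    have : 0 ≤ N * √(M:ℝ) := by positivity
    rw [← k5]
    nlinarith
  rw [ht, div_mul_eq_mul_div, le_div_iff₀ hqpos] at k6
  have k7 : √(M:ℝ) * (N * q) ≤ √(M:ℝ) * (100 * S) := by linarith
  exact le_of_mul_le_mul_left k7 hsM

lemma bad_count {M N : ℕ} (hM : 1 ≤ M) (hMN : 40000 * M ≤ N) :
    ((Finset.univ.filter (fun Y : Fin M → Cube N => ¬ GoodY Y)).card : ℝ) ≤
      2 ^ (M * N) * (2 * Real.exp (-(N / 80))) := by
  have hMr : (1:ℝ) ≤ M := by exact_mod_cast hM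
  have hMNr : 40000 * (M:ℝ) ≤ N := by exact_mod_cast hMN
  have hsM : 0 < √(M:ℝ) := by positivity
  have hsq : √(M:ℝ) ^ 2 = M := Real.sq_sqrt (by positivity)
  set F1 : (Fin M → Cube N) → ℝ := fun Y => ∑ z ∈ netZ M,
    Real.exp (N / 50) * Real.exp (-∑ j, |∑ i, ((z i : ℝ) / (201 * √M)) * pmVal (Y i j)|) with hF1
  set F2 : (Fin M → Cube N) → ℝ := fun Y => ∑ σ : Fin M → Bool, ∑ τ : Fin N → Bool,
    Real.exp (-(4 * N)) * Real.exp ((2 / √M) * ∑ i, ∑ j, pmVal (σ i) * pmVal (τ j) * pmVal (Y i j)) with hF2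
  have p1 : ∀ Y, 0 ≤ F1 Y := fun Y => Finset.sum_nonneg (fun _ _ => by positivity)
  have p2 : ∀ Y, 0 ≤ F2 Y :=
    fun Y => Finset.sum_nonneg (fun _ _ => Finset.sum_nonneg (fun _ _ => by positivity))
  have hbad : ∀ Y, ¬ GoodY Y → 1 ≤ F1 Y + F2 Y := by
    intro Y hY
    by_contra hcon
    push Not at hcon
    apply hY
    apply good_of hM
    · intro z hz
      by_contra hlt
      push Not at hlt
      have : 1 ≤ F1 Y := by
        have h3 := Finset.single_le_sum (f := fun z : Fin M → ℤ =>
          Real.exp (N / 50) * Real.exp (-∑ j, |∑ i, ((z i : ℝ) / (201 * √M)) * pmVal (Y i j)|))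
          (fun _ _ => by positivity) hz
        refine le_trans ?_ h3
        rw [← Real.exp_add]
        apply Real.one_le_exp
        linarith
      linarith [p2 Y]
    · intro σ τ
      by_contra hlt
      push Not at hlt
      have : 1 ≤ F2 Y := by
        have h3 := Finset.single_le_sum (f := fun σ : Fin M → Bool => ∑ τ : Fin N → Bool,
          Real.exp (-(4 * N)) * Real.exp ((2 / √M) * ∑ i, ∑ j, pmVal (σ i) * pmVal (τ j) * pmVal (Y i j)))
          (fun _ _ => Finset.sum_nonneg (fun _ _ => by positivity)) (Finset.mem_univ σ)
        have h4 := Finset.single_le_sum (f := fun τ : Fin N → Bool =>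
          Real.exp (-(4 * N)) * Real.exp ((2 / √M) * ∑ i, ∑ j, pmVal (σ i) * pmVal (τ j) * pmVal (Y i j)))
          (fun _ _ => by positivity) (Finset.mem_univ τ)
        refine le_trans (le_trans ?_ h4) h3
        rw [← Real.exp_add]
        apply Real.one_le_exp
        have : 2 / √(M:ℝ) * (2 * N * √M) ≤
          2 / √(M:ℝ) * ∑ i, ∑ j, pmVal (σ i) * pmVal (τ j) * pmVal (Y i j) := by gcongr
        have h5 : 2 / √(M:ℝ) * (2 * N * √M) = 4 * N := by field_simp; ring
        linarith
      linarith [p1 Y]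
  have s1 : ∑ Y, F1 Y ≤ 2 ^ (M * N) * Real.exp (-(N / 80)) := by
    rw [hF1, Finset.sum_comm]
    have hc := count_int (netZ M) (1/2) (201 * M) (by norm_num) le_rfl
      (fun z hz => (Finset.mem_filter.1 hz).2.1)
    rw [Fintype.card_fin, ← Real.exp_add] at hc
    calc ∑ z ∈ netZ M, ∑ Y : Fin M → Cube N, Real.exp (N / 50) *
          Real.exp (-∑ j, |∑ i, ((z i : ℝ) / (201 * √M)) * pmVal (Y i j)|)
        ≤ ∑ z ∈ netZ M, Real.exp (N / 50) * (2 ^ (M * N) * Real.exp (-(0.045 * N))) := by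
          apply Finset.sum_le_sum
          intro z hz
          rw [← Finset.mul_sum]
          have hz' := (Finset.mem_filter.1 hz).2.2
          have := net_prob (N := N) (fun i => (z i : ℝ) / (201 * √M)) hz'.1 hz'.2
          gcongr
      _ = (netZ M).card * (Real.exp (N / 50) * (2 ^ (M * N) * Real.exp (-(0.045 * N)))) := by
          simp
      _ ≤ Real.exp (201 * M / (1/2) + 4 * (1/2) * M) *
          (Real.exp (N / 50) * (2 ^ (M * N) * Real.exp (-(0.045 * N)))) := by gcongr
      _ = 2 ^ (M * N) * Real.exp (201 * M / (1/2) + 4 * (1/2) * M + N / 50 + -(0.045 * N)) := by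
          rw [Real.exp_add _ (-(0.045 * (N:ℝ))), Real.exp_add _ ((N:ℝ) / 50)]; ring
      _ ≤ _ := by
          gcongr
          linarith
  have s2 : ∑ Y, F2 Y ≤ 2 ^ (M * N) * Real.exp (-(N / 80)) := by
    have e1 : ∑ Y, F2 Y = ∑ σ : Fin M → Bool, ∑ τ : Fin N → Bool, ∑ Y : Fin M → Cube N,
        Real.exp (-(4 * N)) * Real.exp ((2 / √M) * ∑ i, ∑ j, pmVal (σ i) * pmVal (τ j) * pmVal (Y i j)) := by
      rw [hF2, Finset.sum_comm]
      apply Finset.sum_congr rfl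
      intro σ _
      rw [Finset.sum_comm]
    rw [e1]
    calc _ ≤ ∑ σ : Fin M → Bool, ∑ τ : Fin N → Bool,
          Real.exp (-(4 * N)) * (2 ^ (M * N) * Real.exp (2 * N)) := by
          apply Finset.sum_le_sum
          intro σ _
          apply Finset.sum_le_sum
          intro τ _
          rw [← Finset.mul_sum]
          have := sign_prob (2 / √(M:ℝ)) σ τ
          have e : (2 / √(M:ℝ)) ^ 2 * (M * N) / 2 = 2 * N := by
            rw [div_pow, hsq]; field_simp
          rw [e] at this
          gcongr
      _ = (2 ^ M * 2 ^ N) * (2 ^ (M * N) * (Real.exp (-(4 * N)) * Real.exp (2 * N))) := by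
          simp; ring
      _ = 2 ^ (M * N) * ((2 ^ M * 2 ^ N) * Real.exp (-(2 * N))) := by
          rw [← Real.exp_add]; ring_nf
      _ ≤ _ := by
          gcongr
          have hp : ∀ k : ℕ, (2:ℝ) ^ k = Real.exp (k * Real.log 2) := by
            intro k; rw [Real.exp_nat_mul, Real.exp_log (by norm_num)]
          rw [hp, hp, ← Real.exp_add, ← Real.exp_add]
          apply Real.exp_le_exp.2
          have := Real.log_two_lt_d9
          have l0 := Real.log_two_gt_d9
          nlinarith
  calc ((Finset.univ.filter (fun Y : Fin M → Cube N => ¬ GoodY Y)).card : ℝ)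
      = ∑ Y ∈ Finset.univ.filter (fun Y : Fin M → Cube N => ¬ GoodY Y), (1:ℝ) := by simp
    _ ≤ ∑ Y ∈ Finset.univ.filter (fun Y : Fin M → Cube N => ¬ GoodY Y), (F1 Y + F2 Y) :=
        Finset.sum_le_sum (fun Y hY => hbad Y (Finset.mem_filter.1 hY).2)
    _ ≤ ∑ Y, (F1 Y + F2 Y) :=
        Finset.sum_le_sum_of_subset_of_nonneg (Finset.filter_subset _ _)
          (fun Y _ _ => add_nonneg (p1 Y) (p2 Y))
    _ ≤ _ := by rw [Finset.sum_add_distrib]; linarith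

lemma frac_sol {M N : ℕ} (Y : Fin M → Cube N) (hY : GoodY Y) (K : ℝ) (hK : 0 ≤ K)
    (hMN : (100 * K) ^ 2 * M ≤ N) :
    ∃ x : Fin N → ℝ, (∀ j, |x j| ≤ 1) ∧ ∀ i, ∑ j, pmVal (Y i j) * x j = K * √N := by
  set A : Matrix (Fin M) (Fin N) ℝ := fun i j => pmVal (Y i j) with hA
  set L : (Fin N → ℝ) →ₗ[ℝ] (Fin M → ℝ) := Matrix.mulVecLin A with hL
  set C : Set (Fin M → ℝ) := L '' (Set.Icc (-1) 1) with hC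
  have hLv : ∀ x i, L x i = ∑ j, pmVal (Y i j) * x j := by
    intro x i; rfl
  have hconv : Convex ℝ C := (convex_Icc _ _).linear_image L
  have hcl : IsClosed C :=
    (isCompact_Icc.image (LinearMap.continuous_of_finiteDimensional L)).isClosed
  by_cases hmem : (fun _ => K * √N : Fin M → ℝ) ∈ C
  · obtain ⟨x, hx, hxe⟩ := hmem
    refine ⟨x, fun j => abs_le.2 ⟨hx.1 j, hx.2 j⟩, fun i => ?_⟩
    rw [← hLv, hxe]
  exfalso
  obtain ⟨f, u, hf1, hf2⟩ := geometric_hahn_banach_closed_point hconv hcl hmem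
  set l : Fin M → ℝ := fun i => f (Pi.single i 1) with hl
  have hf : ∀ v, f v = ∑ i, l i * v i := by
    intro v
    conv_lhs => rw [pi_eq_sum_univ' v]
    rw [map_sum]
    apply Finset.sum_congr rfl
    intro i _
    rw [map_smul, smul_eq_mul, mul_comm]
  choose τ hτ using fun j => pm_sign (∑ i, l i * pmVal (Y i j))
  have hτC : L (fun j => pmVal (τ j)) ∈ C := by
    refine ⟨_, ⟨fun j => ?_, fun j => ?_⟩, rfl⟩ <;> simp only [pmVal] <;> split_ifs <;> simp
  have h1 := hf1 _ hτC
  have e1 : f (L (fun j => pmVal (τ j))) = ∑ j, |∑ i, l i * pmVal (Y i j)| := by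
    rw [hf]
    simp_rw [hLv, ← hτ, Finset.mul_sum]
    rw [Finset.sum_comm]
    apply Finset.sum_congr rfl
    intro i _
    apply Finset.sum_congr rfl
    intros; ring
  rw [hf, ← Finset.sum_mul] at hf2
  have h2 := hY l
  rw [e1] at h1
  set S := ∑ j, |∑ i, l i * pmVal (Y i j)| with hS
  set q := √(∑ i, l i ^ 2) with hq
  have hq0 : 0 ≤ q := Real.sqrt_nonneg _
  have h3 : ∑ i, l i ≤ √M * q := by
    rw [hq, ← Real.sqrt_mul (by positivity)]
    apply Real.le_sqrt_of_sq_le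
    have := sq_sum_le_card_mul_sum_sq (s := (Finset.univ : Finset (Fin M))) (f := l)
    simpa using this
  have h4 : 100 * K * √M ≤ √N := by
    apply Real.le_sqrt_of_sq_le
    rw [mul_pow, Real.sq_sqrt (by positivity)]
    exact hMN
  have h5 : (∑ i, l i) * (K * √N) ≤ √M * q * (K * √N) := by gcongr
  have h6 : 100 * K * √M * (q * √N) ≤ √N * (q * √N) := by gcongr
  have h7 : √(N:ℝ) * √N = N := Real.mul_self_sqrt (by positivity)
  have h8 : √(N:ℝ) * (q * √N) = N * q := by
    calc _ = (√(N:ℝ) * √N) * q := by ring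
      _ = _ := by rw [h7]
  nlinarith

lemma good_nonempty {M N : ℕ} (κ : ℝ) (Y : Fin M → Cube N) (hY : GoodY Y) (hMN' : M ≤ N) (hN : 1 ≤ N)
    (hMN : (100 * (|κ| + 3000)) ^ 2 * M ≤ N) : (⋂ i, halfCube κ (Y i)).Nonempty := by
  obtain ⟨x, hx1, hx2⟩ := frac_sol Y hY (|κ| + 3000) (by positivity) hMN
  obtain ⟨y, hy⟩ := rounding N (by simpa using hMN') (fun i j => pmVal (Y i j))
    (fun i j => by simp only [pmVal]; split_ifs <;> simp) x hx1
  refine ⟨y, ?_⟩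
  rw [Set.mem_iInter]
  intro i
  have h1 := hy i
  rw [hx2 i] at h1
  have h2 := (abs_le.1 h1).2
  show cubeDot (Y i) y ≥ κ * √N
  unfold cubeDot
  have h3 : 1 ≤ √(N:ℝ) := by rw [Real.one_le_sqrt]; exact_mod_cast hN
  have h4 : κ * √N ≤ |κ| * √N := by gcongr; exact le_abs_self κ
  linarith

/-- For every `κ` there are constants `c₄, c > 0` depending only on `κ` such
that for all sufficiently large `N`: for i.i.d. uniform `Y_1, …, Y_{⌊c₄N⌋}` in
`Σ_N`, the probability that `⋂_i H(Y_i)` is nonempty is at least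
`1 - e^{-cN}`. -/
theorem intersection_nonempty_whp (κ : ℝ) :
    ∃ c₄ > (0 : ℝ), ∃ c > (0 : ℝ), ∃ N₀ : ℕ, ∀ N : ℕ, N₀ ≤ N →
      unifP {Y : Fin ⌊c₄ * (N : ℝ)⌋₊ → Cube N |
          (⋂ i, halfCube κ (Y i)).Nonempty} ≥ 1 - Real.exp (-c * N) := by
  set Q : ℝ := (100 * (|κ| + 3000)) ^ 2 with hQ
  have hQ1 : 40000 ≤ Q := by
    have := abs_nonneg κ
    rw [hQ]; nlinarith
  have hQpos : 0 < Q := by linarith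
  refine ⟨1 / Q, by positivity, 1 / 160, by norm_num, max 160 (⌈Q⌉₊), ?_⟩
  intro N hN
  have hN1 : 160 ≤ N := (le_max_left _ _).trans hN
  have hN2 : Q ≤ N := (Nat.le_ceil Q).trans (by exact_mod_cast (le_max_right _ _).trans hN)
  have hN1r : (160:ℝ) ≤ N := by exact_mod_cast hN1
  have hMfl : (⌊1 / Q * (N:ℝ)⌋₊ : ℝ) ≤ 1 / Q * N := Nat.floor_le (by positivity)
  have hM1 : 1 ≤ ⌊1 / Q * (N:ℝ)⌋₊ := by
    apply Nat.le_floor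
    rw [Nat.cast_one, one_div_mul_eq_div, le_div_iff₀ hQpos]; linarith
  generalize ⌊1 / Q * (N:ℝ)⌋₊ = M at *
  have hMN : Q * M ≤ N := by
    have : Q * (1 / Q * N) = N := by field_simp
    nlinarith
  have hM0 : (0:ℝ) ≤ M := by positivity
  have hMN2 : 40000 * M ≤ N := by
    have : 40000 * (M:ℝ) ≤ N := by nlinarith
    exact_mod_cast this
  have hb := bad_count hM1 hMN2
  have hsub : (↑(Finset.univ.filter (fun Y : Fin M → Cube N => GoodY Y)) : Set (Fin M → Cube N)) ⊆
      {Y : Fin M → Cube N | (⋂ i, halfCube κ (Y i)).Nonempty} := by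
    intro Y hY
    have hY' : GoodY Y := by simpa using hY
    exact good_nonempty κ Y hY' (by omega) (by omega) hMN
  have hcard := Set.ncard_le_ncard hsub (Set.toFinite _)
  rw [Set.ncard_coe_finset] at hcard
  have h2 := Finset.card_filter_add_card_filter_not (s := (Finset.univ : Finset (Fin M → Cube N)))
      (fun Y => GoodY Y)
  have h3 : (Finset.univ : Finset (Fin M → Cube N)).card = 2 ^ (M * N) := by
    simp [← pow_mul, mul_comm]
  rw [h3] at h2
  have h4 : ((Finset.univ.filter (fun Y : Fin M → Cube N => GoodY Y)).card : ℝ) +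
      ((Finset.univ.filter (fun Y : Fin M → Cube N => ¬ GoodY Y)).card : ℝ) = 2 ^ (M * N) := by
    exact_mod_cast h2
  have h5 : ((Finset.univ.filter (fun Y : Fin M → Cube N => GoodY Y)).card : ℝ) ≤
    ({Y : Fin M → Cube N | (⋂ i, halfCube κ (Y i)).Nonempty}.ncard : ℝ) := by exact_mod_cast hcard
  have h6 : (Fintype.card (Fin M → Cube N) : ℝ) = 2 ^ (M * N) := by
    rw [← Finset.card_univ, h3]; push_cast; rfl
  have h7 : 2 * Real.exp (-((N:ℝ) / 80)) ≤ Real.exp (-(1 / 160) * N) := by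
    have e : Real.exp (-((N:ℝ) / 80)) = Real.exp (-(1 / 160) * N) * Real.exp (-(1 / 160) * N) := by
      rw [← Real.exp_add]; ring_nf
    have e2 : Real.exp (-(1 / 160) * (N:ℝ)) ≤ 1 / 2 := by
      refine (Real.exp_le_exp.2 (by linarith : -(1 / 160) * (N:ℝ) ≤ -1)).trans ?_
      rw [Real.exp_neg, inv_le_comm₀ (Real.exp_pos _) (by norm_num)]
      have := Real.exp_one_gt_d9
      norm_num; linarith
    rw [e]
    nlinarith [Real.exp_pos (-(1 / 160) * (N:ℝ))]
  unfold unifP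
  rw [ge_iff_le, h6, le_div_iff₀ (by positivity)]
  have h8 : (2:ℝ) ^ (M * N) * (2 * Real.exp (-((N:ℝ) / 80))) ≤
    2 ^ (M * N) * Real.exp (-(1 / 160) * N) := by gcongr
  linarith
end
end

section
/- For every κ ∈ ℝ there exist constants K, γ > 0 depending only on κ with the following property: for all N, all r ≥ 1, and all σ¹,…,σʳ ∈ Σ_N such that (1/N) Σ_{i≤N} σ_i^p σ_i^q ≤ 1/2 whenever p ≠ q, if ξ is a uniform random vector in Σ_N, then ℙ(σ^p ∉ H(ξ) for all p = 1,…,r) ≤ K r^{-γ}. -/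
open scoped Classical

noncomputable section


def CLip {N : ℕ} (F : Cube N → ℝ) : Prop :=
  ∀ x y, F x - F y ≤ ∑ i, |pmVal (x i) - pmVal (y i)|

lemma sum_cube_succ {N : ℕ} (G : Cube (N+1) → ℝ) :
    ∑ x, G x = ∑ y : Cube N, (G (Fin.cons true y) + G (Fin.cons false y)) := by
  rw [← (Fin.consEquiv (fun _ : Fin (N+1) => Bool)).sum_comp, Fintype.sum_prod_type]
  simp [Fin.consEquiv, Finset.sum_add_distrib]

lemma mgf_bound_s16 (N : ℕ) : ∀ (F : Cube N → ℝ), CLip F → ∀ l : ℝ,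
    ∑ x, Real.exp (l * F x) ≤
      2 ^ N * Real.exp (l * ((∑ x, F x) / 2 ^ N) + l ^ 2 * N / 2) := by
  induction N with
  | zero =>
    intro F hF l
    simp
  | succ n ih =>
    intro F hF l
    rw [sum_cube_succ, sum_cube_succ]
    set A : Cube n → ℝ := fun y => (F (Fin.cons true y) + F (Fin.cons false y)) / 2 with hA
    have hAL : CLip A := by
      intro x y
      have h1 := hF (Fin.cons true x) (Fin.cons true y)
      have h2 := hF (Fin.cons false x) (Fin.cons false y)
      rw [Fin.sum_univ_succ] at h1 h2
      simp at h1 h2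
      simp only [hA]
      linarith
    have key : ∀ y : Cube n, Real.exp (l * F (Fin.cons true y)) + Real.exp (l * F (Fin.cons false y))
        ≤ 2 * Real.exp (l ^ 2 / 2) * Real.exp (l * A y) := by
      intro y
      set d := (F (Fin.cons true y) - F (Fin.cons false y)) / 2 with hd
      have h1 := hF (Fin.cons true y) (Fin.cons false y)
      have h2 := hF (Fin.cons false y) (Fin.cons true y)
      rw [Fin.sum_univ_succ] at h1 h2
      simp [pmVal] at h1 h2
      norm_num at h1 h2
      have e1 : l * F (Fin.cons true y) = l * A y + l * d := by simp only [hA, hd]; ring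
      have e2 : l * F (Fin.cons false y) = l * A y + -(l * d) := by simp only [hA, hd]; ring
      have hc : Real.cosh (l * d) ≤ Real.exp (l ^ 2 / 2) := by
        refine (Real.cosh_le_exp_half_sq _).trans (Real.exp_le_exp.2 ?_)
        have : d ^ 2 ≤ 1 := by
          have a1 : d ≤ 1 := by rw [hd]; linarith
          have a2 : -1 ≤ d := by rw [hd]; linarith
          nlinarith
        nlinarith [sq_nonneg l]
      rw [e1, e2, Real.exp_add, Real.exp_add]
      rw [Real.cosh_eq] at hc
      nlinarith [Real.exp_pos (l * A y)]
    calc _ ≤ ∑ y : Cube n, 2 * Real.exp (l ^ 2 / 2) * Real.exp (l * A y) :=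
          Finset.sum_le_sum fun y _ => key y
      _ = 2 * Real.exp (l ^ 2 / 2) * ∑ y, Real.exp (l * A y) := by rw [Finset.mul_sum]
      _ ≤ 2 * Real.exp (l ^ 2 / 2) * (2 ^ n * Real.exp (l * ((∑ x, A x) / 2 ^ n) + l ^ 2 * n / 2)) :=
          mul_le_mul_of_nonneg_left (ih A hAL l) (by positivity)
      _ = _ := by
          have : ∑ x, A x = (∑ y : Cube n, (F (Fin.cons true y) + F (Fin.cons false y))) / 2 := by
            rw [Finset.sum_div]
          rw [this]
          set Z := ∑ y : Cube n, (F (Fin.cons true y) + F (Fin.cons false y))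
          have e : l * (Z / 2 ^ (n+1)) + l ^ 2 * ((n+1 : ℕ) : ℝ) / 2
              = l ^ 2 / 2 + (l * (Z / 2 / 2 ^ n) + l ^ 2 * n / 2) := by
            push_cast; rw [pow_succ]; field_simp; ring
          rw [e, Real.exp_add (l ^ 2 / 2), pow_succ]; ring

lemma sum_exp_two {N : ℕ} (a b : Cube N) (l : ℝ) :
    ∑ x : Cube N, Real.exp (l / 2 * cubeDot x a) * Real.exp (l / 2 * cubeDot x b) =
      2 ^ N * Real.exp (Real.log (Real.cosh l) * (N + cubeDot a b) / 2) := by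
  have h1 : ∀ x : Cube N, Real.exp (l / 2 * cubeDot x a) * Real.exp (l / 2 * cubeDot x b) =
      ∏ i, Real.exp (l / 2 * (pmVal (x i) * (pmVal (a i) + pmVal (b i)))) := by
    intro x
    rw [← Real.exp_add, ← Real.exp_sum]
    congr 1
    simp only [cubeDot, Finset.mul_sum, ← Finset.sum_add_distrib]
    refine Finset.sum_congr rfl fun i _ => by ring
  simp_rw [h1]
  have h2 := Finset.prod_univ_sum (fun _ : Fin N => (Finset.univ : Finset Bool))
    (fun i c => Real.exp (l / 2 * (pmVal c * (pmVal (a i) + pmVal (b i)))))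
  rw [Fintype.piFinset_univ] at h2
  rw [← h2]
  have h3 : ∀ i : Fin N, ∑ c : Bool, Real.exp (l / 2 * (pmVal c * (pmVal (a i) + pmVal (b i))))
      = 2 * Real.exp (Real.log (Real.cosh l) * (1 + pmVal (a i) * pmVal (b i)) / 2) := by
    intro i
    have hl := Real.exp_log (Real.cosh_pos l)
    have hc := Real.cosh_eq l
    rcases a i <;> rcases b i <;> simp [pmVal] <;> norm_num
    · rw [hl]; linarith
    · rw [hl]; linarith
  simp_rw [h3]
  rw [Finset.prod_mul_distrib, ← Real.exp_sum]
  simp only [Finset.prod_const, Finset.card_univ, Fintype.card_fin]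
  congr 2
  simp only [cubeDot]
  rw [← Finset.sum_div, ← Finset.mul_sum, Finset.sum_add_distrib]
  simp

lemma cubeDot_self {N : ℕ} (a : Cube N) : cubeDot a a = N := by
  have : ∀ i, pmVal (a i) * pmVal (a i) = 1 := by
    intro i; rcases a i <;> simp [pmVal]
  simp [cubeDot, this]

lemma dot_clip {N : ℕ} (a : Cube N) : CLip (fun x => cubeDot x a) := by
  intro x y
  simp only [cubeDot, ← Finset.sum_sub_distrib]
  refine Finset.sum_le_sum fun i _ => ?_
  rcases a i <;> rcases x i <;> rcases y i <;> simp [pmVal] <;> norm_num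

def maxF {N r : ℕ} (hr : 1 ≤ r) (σ : Fin r → Cube N) (x : Cube N) : ℝ :=
  Finset.univ.sup' ⟨⟨0, hr⟩, Finset.mem_univ _⟩ (fun p => cubeDot x (σ p))

lemma le_maxF {N r : ℕ} (hr : 1 ≤ r) (σ : Fin r → Cube N) (x : Cube N) (p : Fin r) :
    cubeDot x (σ p) ≤ maxF hr σ x :=
  Finset.le_sup' (fun p => cubeDot x (σ p)) (Finset.mem_univ p)

lemma maxF_clip {N r : ℕ} (hr : 1 ≤ r) (σ : Fin r → Cube N) : CLip (maxF hr σ) := by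
  intro x y
  have : maxF hr σ x ≤ maxF hr σ y + ∑ i, |pmVal (x i) - pmVal (y i)| := by
    refine Finset.sup'_le _ _ fun p _ => ?_
    have h1 := dot_clip (σ p) x y
    have h2 := le_maxF hr σ y p
    simp only at h1
    linarith
  linarith

lemma lower_mgf {N r : ℕ} (hr : 1 ≤ r) (σ : Fin r → Cube N)
    (hσ : ∀ p q, p ≠ q → cubeDot (σ p) (σ q) ≤ N / 2) (l : ℝ) (hl : 0 ≤ l)
    (hlr : Real.exp (Real.log (Real.cosh l) * N / 4) ≤ r) :
    2 ^ N * (Real.exp (5 * (Real.log (Real.cosh l) * N / 4)) / 2) ≤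
      ∑ x, Real.exp (l * maxF hr σ x) := by
  have hpos : 0 ≤ Real.log (Real.cosh l) := Real.log_nonneg (Real.one_le_cosh l)
  set L := Real.log (Real.cosh l) with hL
  set E := Real.exp (L * N / 4) with hE
  have hE0 : 0 < E := Real.exp_pos _
  have hEp : ∀ k : ℕ, Real.exp (k * (L * N / 4)) = E ^ k := fun k => Real.exp_nat_mul _ _
  have hr0 : (0:ℝ) < r := by exact_mod_cast hr
  set T : Cube N → ℝ := fun x => ∑ p, Real.exp (l / 2 * cubeDot x (σ p)) with hT
  set f : Cube N → ℝ := fun x => Real.exp (l / 2 * maxF hr σ x) with hf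
  have hdiag : ∀ p, ∑ x : Cube N, Real.exp (l / 2 * cubeDot x (σ p)) *
      Real.exp (l / 2 * cubeDot x (σ p)) = 2 ^ N * E ^ 4 := by
    intro p
    rw [sum_exp_two, cubeDot_self, ← hEp]
    congr 2
    push_cast; ring
  have hoff : ∀ p q, p ≠ q → ∑ x : Cube N, Real.exp (l / 2 * cubeDot x (σ p)) *
      Real.exp (l / 2 * cubeDot x (σ q)) ≤ 2 ^ N * E ^ 3 := by
    intro p q hpq
    rw [sum_exp_two, ← hEp]
    refine mul_le_mul_of_nonneg_left (Real.exp_le_exp.2 ?_) (by positivity)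
    have := mul_le_mul_of_nonneg_left (hσ p q hpq) hpos
    push_cast
    linarith
  have h1 : (r:ℝ) * (2 ^ N * E ^ 4) ≤ ∑ x, f x * T x := by
    have : (r:ℝ) * (2 ^ N * E ^ 4) = ∑ x : Cube N, ∑ p, Real.exp (l / 2 * cubeDot x (σ p)) *
      Real.exp (l / 2 * cubeDot x (σ p)) := by
      rw [Finset.sum_comm]; simp [hdiag]
    rw [this]
    refine Finset.sum_le_sum fun x _ => ?_
    simp only [hT, Finset.mul_sum]
    refine Finset.sum_le_sum fun p _ => ?_
    refine mul_le_mul_of_nonneg_right (Real.exp_le_exp.2 ?_) (Real.exp_pos _).le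
    exact mul_le_mul_of_nonneg_left (le_maxF hr σ x p) (by linarith)
  have h2 : ∑ x, T x ^ 2 ≤ 2 * (2 ^ N * (r ^ 2 * E ^ 3)) := by
    have e : ∑ x, T x ^ 2 = ∑ p, ∑ q, ∑ x : Cube N, Real.exp (l / 2 * cubeDot x (σ p)) *
      Real.exp (l / 2 * cubeDot x (σ q)) := by
      simp only [hT, sq, Finset.sum_mul_sum]
      rw [Finset.sum_comm]
      refine Finset.sum_congr rfl fun p _ => ?_
      rw [Finset.sum_comm]
    have b : ∀ p q, ∑ x : Cube N, Real.exp (l / 2 * cubeDot x (σ p)) *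
      Real.exp (l / 2 * cubeDot x (σ q)) ≤ 2 ^ N * E ^ 3 + (if p = q then 2 ^ N * E ^ 4 else 0) := by
      intro p q
      split_ifs with h
      · subst h; rw [hdiag]
        have : (0:ℝ) ≤ 2 ^ N * E ^ 3 := by positivity
        linarith
      · simpa using hoff p q h
    rw [e]
    calc _ ≤ ∑ p : Fin r, ∑ q : Fin r, ((2:ℝ) ^ N * E ^ 3 + (if p = q then 2 ^ N * E ^ 4 else 0)) :=
          Finset.sum_le_sum fun p _ => Finset.sum_le_sum fun q _ => b p q
      _ = (2:ℝ) ^ N * (r ^ 2 * E ^ 3) + (2 ^ N * (r * E ^ 3)) * E := by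
          simp [Finset.sum_add_distrib]; ring
      _ ≤ (2:ℝ) ^ N * (r ^ 2 * E ^ 3) + (2 ^ N * (r * E ^ 3)) * r := by
          gcongr
      _ = _ := by ring
  have h3 : ∑ x, f x ^ 2 = ∑ x, Real.exp (l * maxF hr σ x) := by
    refine Finset.sum_congr rfl fun x _ => ?_
    simp only [hf]
    rw [sq, ← Real.exp_add]; congr 1; ring
  have h4 := Finset.sum_mul_sq_le_sq_mul_sq Finset.univ f T
  rw [h3] at h4
  have h5 : ((r:ℝ) * (2 ^ N * E ^ 4)) ^ 2 ≤ (∑ x, f x * T x) ^ 2 :=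
    pow_le_pow_left₀ (by positivity) h1 2
  set W := ∑ x, Real.exp (l * maxF hr σ x) with hW
  have hW0 : 0 ≤ W := Finset.sum_nonneg fun x _ => (Real.exp_pos _).le
  have h6 : ((r:ℝ) * (2 ^ N * E ^ 4)) ^ 2 ≤ W * (2 * (2 ^ N * (r ^ 2 * E ^ 3))) :=
    h5.trans (h4.trans (mul_le_mul_of_nonneg_left h2 hW0))
  have e5 : Real.exp (5 * (L * N / 4)) = E ^ 5 := by rw [← hEp]; norm_num
  rw [e5]
  have hc : (0:ℝ) < 2 * (2 ^ N * (r ^ 2 * E ^ 3)) := by positivity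
  refine le_of_mul_le_mul_right (le_trans (le_of_eq ?_) h6) hc
  ring

lemma log_cosh_lower (l : ℝ) (hl : l ^ 2 ≤ 1 / 4) :
    0.47 * l ^ 2 ≤ Real.log (Real.cosh l) := by
  have h1 : 1 + l ^ 2 / 2 ≤ Real.cosh l := by
    have key : ∀ x : ℝ, 0 ≤ x → 1 + x ^ 2 / 2 ≤ Real.cosh x := by
      intro x hx
      have h := Real.self_le_sinh_iff.2 (show 0 ≤ x / 2 by linarith)
      have h2 := Real.cosh_two_mul (x / 2)
      have h3 := Real.cosh_sq (x / 2)
      rw [show 2 * (x / 2) = x by ring] at h2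
      nlinarith
    have := key |l| (abs_nonneg l)
    rwa [sq_abs, Real.cosh_abs] at this
  have h2 := Real.le_log_one_add_of_nonneg (x := l ^ 2 / 2) (by positivity)
  have h3 := Real.log_le_log (by positivity) h1
  refine le_trans ?_ (h2.trans h3)
  rw [le_div_iff₀ (by positivity)]
  nlinarith [sq_nonneg l]

lemma log_cosh_upper (l : ℝ) : Real.log (Real.cosh l) ≤ l ^ 2 / 2 := by
  rw [Real.log_le_iff_le_exp (Real.cosh_pos l)]
  exact Real.cosh_le_exp_half_sq l

/-- For every `κ` there are constants `K, γ > 0` depending only on `κ` with the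
following property: for all `N`, all `r ≥ 1` and all `σ¹, …, σʳ ∈ Σ_N` with
`(1/N) ∑_{i ≤ N} σᵖ_i σ^q_i ≤ 1/2` whenever `p ≠ q`, if `ξ` is uniform in
`Σ_N` then `ℙ(σᵖ ∉ H(ξ) for all p) ≤ K r^{-γ}`. -/
theorem miss_all_prob_bound (κ : ℝ) :
    ∃ K > (0 : ℝ), ∃ γ > (0 : ℝ), ∀ N : ℕ, ∀ r : ℕ, 1 ≤ r →
      ∀ σ : Fin r → Cube N,
        (∀ p q : Fin r, p ≠ q → (1 / (N : ℝ)) * cubeDot (σ p) (σ q) ≤ 1 / 2) →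
        unifP {ξ : Cube N | ∀ p : Fin r, σ p ∉ halfCube κ ξ} ≤
          K * (r : ℝ) ^ (-γ) := by
  refine ⟨Real.exp (κ ^ 2 + 1), Real.exp_pos _, 0.0004, by norm_num, ?_⟩
  intro N r hr σ hσ
  have hr0 : (0:ℝ) < r := by exact_mod_cast hr
  rcases Nat.eq_zero_or_pos N with rfl | hN
  · have : {ξ : Cube 0 | ∀ p : Fin r, σ p ∉ halfCube κ ξ} = ∅ := by
      ext ξ
      simp only [Set.mem_setOf_eq, Set.mem_empty_iff_false, iff_false, not_forall, not_not]
      exact ⟨⟨0, hr⟩, by simp [halfCube, cubeDot]⟩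
    rw [this]
    simp only [unifP, Set.ncard_empty, Nat.cast_zero, zero_div]
    positivity
  have hN0 : (0:ℝ) < N := by exact_mod_cast hN
  have hσ' : ∀ p q, p ≠ q → cubeDot (σ p) (σ q) ≤ N / 2 := by
    intro p q h
    have := hσ p q h
    rw [one_div_mul_eq_div, div_le_iff₀ hN0] at this
    linarith
  have hinj : Function.Injective σ := by
    intro p q h
    by_contra hne
    have := hσ' p q hne
    rw [h, cubeDot_self] at this
    linarith
  have hcard : (r:ℝ) ≤ 2 ^ N := by
    have := Fintype.card_le_of_injective σ hinj
    simp at this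
    exact_mod_cast this
  have hlog0 : 0 ≤ Real.log r := Real.log_nonneg (by exact_mod_cast hr)
  have hlogr : Real.log r ≤ N := by
    have h := Real.log_le_log hr0 hcard
    rw [Real.log_pow] at h
    have := Real.log_two_lt_d9
    nlinarith
  set w := Real.sqrt (Real.log r / 4) with hw
  have hw2 : w ^ 2 = Real.log r / 4 := Real.sq_sqrt (by positivity)
  have hw0 : 0 ≤ w := Real.sqrt_nonneg _
  have hsN : 0 < Real.sqrt N := Real.sqrt_pos.2 hN0
  have hsN2 : Real.sqrt N ^ 2 = N := Real.sq_sqrt hN0.le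
  set l := w / Real.sqrt N with hl
  have hl0 : 0 ≤ l := by positivity
  have hlN : l * Real.sqrt N = w := by rw [hl]; field_simp
  have hl2N : l ^ 2 * N = w ^ 2 := by rw [← hsN2, ← mul_pow, hlN]
  have hl2 : l ^ 2 ≤ 1 / 4 := by
    have : l ^ 2 * N ≤ 1 / 4 * N := by rw [hl2N, hw2]; linarith
    exact le_of_mul_le_mul_right this hN0
  have hlr : Real.exp (Real.log (Real.cosh l) * N / 4) ≤ r := by
    rw [← Real.le_log_iff_exp_le hr0]
    have := mul_le_mul_of_nonneg_right (log_cosh_upper l) hN0.le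
    nlinarith
  set M := (∑ x, maxF hr σ x) / 2 ^ N with hM
  have hup := mgf_bound_s16 N (maxF hr σ) (maxF_clip hr σ) l
  have hlow := lower_mgf hr σ hσ' l hl0 hlr
  have hMl : 0.08 * w ^ 2 - Real.log 2 ≤ l * M := by
    have h := le_of_mul_le_mul_left (hlow.trans hup) (by positivity)
    have e : Real.exp (5 * (Real.log (Real.cosh l) * N / 4)) / 2
        = Real.exp (5 * (Real.log (Real.cosh l) * N / 4) - Real.log 2) := by
      rw [Real.exp_sub, Real.exp_log (by norm_num)]
    rw [e, Real.exp_le_exp] at h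
    have h2 := mul_le_mul_of_nonneg_right (log_cosh_lower l hl2) hN0.le
    have : 0 ≤ w ^ 2 := sq_nonneg w
    norm_num at h h2 ⊢
    nlinarith
  -- Chernoff
  set A := {ξ : Cube N | ∀ p : Fin r, σ p ∉ halfCube κ ξ} with hA
  set s := 0.08 * l with hs
  have hs0 : 0 ≤ s := by positivity
  have hmem : ∀ x ∈ A, maxF hr σ x ≤ κ * Real.sqrt N := by
    intro x hx
    refine Finset.sup'_le _ _ fun p _ => ?_
    have := hx p
    simp only [halfCube, Set.mem_setOf_eq, not_le, ge_iff_le] at this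
    exact this.le
  have hch : (A.ncard : ℝ) ≤ ∑ x, Real.exp (-s * maxF hr σ x) * Real.exp (s * (κ * Real.sqrt N)) := by
    rw [Set.ncard_eq_toFinset_card', Finset.card_eq_sum_ones]
    push_cast
    calc _ ≤ ∑ x ∈ A.toFinset, Real.exp (-s * maxF hr σ x) * Real.exp (s * (κ * Real.sqrt N)) := by
          refine Finset.sum_le_sum fun x hx => ?_
          rw [← Real.exp_add]
          apply Real.one_le_exp
          have := mul_le_mul_of_nonneg_left (hmem x (by simpa using hx)) hs0
          linarith
      _ ≤ _ := Finset.sum_le_sum_of_subset_of_nonneg (Finset.subset_univ _)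
          fun _ _ _ => by positivity
  rw [← Finset.sum_mul] at hch
  have hup2 := mgf_bound_s16 N (maxF hr σ) (maxF_clip hr σ) (-s)
  have hch2 := hch.trans (mul_le_mul_of_nonneg_right hup2 (Real.exp_pos _).le)
  unfold unifP
  have hc : (Fintype.card (Cube N) : ℝ) = 2 ^ N := by simp
  rw [hc, div_le_iff₀ (by positivity)]
  refine hch2.trans ?_
  rw [mul_assoc, mul_comm, ← Real.exp_add]
  refine mul_le_mul_of_nonneg_right ?_ (by positivity)
  rw [Real.rpow_def_of_pos hr0, ← Real.exp_add, Real.exp_le_exp]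
  have hlog2 := Real.log_two_lt_d9
  have e1 : s * (κ * Real.sqrt N) = 0.08 * κ * w := by rw [← hlN, hs]; ring
  have e2 : (-s) ^ 2 * N / 2 = 0.0032 * w ^ 2 := by rw [← hl2N, hs]; ring
  have e3 : -s * M = -(0.08 * (l * M)) := by rw [hs]; ring
  rw [← hM, e1, e2, e3]
  have e4 : Real.log r = 4 * w ^ 2 := by rw [hw2]; ring
  rw [e4]
  norm_num at hMl ⊢
  nlinarith [sq_nonneg (κ - 0.04 * w)]
end
end
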